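/- arXiv:2308.02791 — 2 statements merged into one kernel-verified Lean document; each statement's English description precedes it below -/
import Mathlib

section
/- For every pair of integers (p, r) with p ≥ 0 and r ≥ 2, there exists a bipartite graph G such that the toric ideal I_G of its edge ring satisfies pdim(I_G) = p and reg(I_G) = r. In particular, the graph B_{ℓ̲,h} with h = p+2 and ℓ̲ = (1,…,1,r−1) (h−1 ones) has this property, since pdim(I_{B_{ℓ̲,h}}) = h−2 and reg(I_{B_{ℓ̲,h}}) = ℓ₁+⋯+ℓ_h − h + 2. -/
open MvPolynomial

/-- Data of a minimal graded free complex over `MvPolynomial σ K`: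
free modules `F i = Fin (N i) → R` with generator degrees `g i`, differentials `d i`,
exactness at every positive stage and homogeneous minimal (entries of positive degree)
differentials. -/
structure MinFreeResData (K : Type) [Field K] (σ : Type) where
  N : ℕ → ℕ
  g : (i : ℕ) → Fin (N i) → ℕ
  d : (i : ℕ) →
    ((Fin (N (i + 1)) → MvPolynomial σ K) →ₗ[MvPolynomial σ K] (Fin (N i) → MvPolynomial σ K))
  hexact : ∀ i, LinearMap.range (d (i + 1)) = LinearMap.ker (d i)
  hdeg : ∀ i k l, if g i l < g (i + 1) k
      then d i (Pi.single k 1) l ∈ homogeneousSubmodule σ K (g (i + 1) k - g i l)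
      else d i (Pi.single k 1) l = 0

/-- A minimal graded free resolution of an ideal `I` (as a graded module). -/
structure MinFreeResOfIdeal {K : Type} [Field K] {σ : Type} (I : Ideal (MvPolynomial σ K))
    extends MinFreeResData K σ where
  ε : (Fin (N 0) → MvPolynomial σ K) →ₗ[MvPolynomial σ K] MvPolynomial σ K
  hrange : LinearMap.range ε = I
  hker : LinearMap.ker ε = LinearMap.range (d 0)
  hεdeg : ∀ k, ε (Pi.single k 1) ∈ homogeneousSubmodule σ K (g 0 k)

/-- The graded Betti number `β_{i,j}` read off from a minimal free resolution. -/
def MinFreeResData.betti {K : Type} [Field K] {σ : Type}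
    (res : MinFreeResData K σ) (i j : ℕ) : ℕ :=
  (Finset.univ.filter fun k => res.g i k = j).card

/-- Projective dimension, `max{i : β_{i,j} ≠ 0 for some j}`, as an element of `ℕ∞`. -/
noncomputable def MinFreeResData.pdim {K : Type} [Field K] {σ : Type}
    (res : MinFreeResData K σ) : ℕ∞ :=
  sSup ((fun i : ℕ => (i : ℕ∞)) '' {i | ∃ j, res.betti i j ≠ 0})

/-- Castelnuovo–Mumford regularity, `max{j - i : β_{i,j} ≠ 0}`, as an element of `ℕ∞`. -/
noncomputable def MinFreeResData.reg {K : Type} [Field K] {σ : Type}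
    (res : MinFreeResData K σ) : ℕ∞ :=
  sSup ((fun p : ℕ × ℕ => ((p.2 - p.1 : ℕ) : ℕ∞)) '' {p | res.betti p.1 p.2 ≠ 0})


/-- The toric ideal `I_G` of a simple graph `G`: the kernel of the `K`-algebra map
`K[e : e ∈ E(G)] → K[x : x ∈ V(G)]` sending an edge variable to the product of its two
endpoints. -/
noncomputable def toricIdeal (K : Type) [Field K] {V : Type} (G : SimpleGraph V) :
    Ideal (MvPolynomial G.edgeSet K) :=
  RingHom.ker (MvPolynomial.aeval (R := K) (fun e : G.edgeSet =>
    Sym2.lift ⟨fun a b => (X a * X b : MvPolynomial V K),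
      fun a b => mul_comm _ _⟩ (e : Sym2 V))).toRingHom


namespace EN

/-- index of the basis of the exterior algebra -/
def B : ℕ → Type
  | 0 => Unit
  | n + 1 => B n ⊕ B n

instance instFintypeB : (n : ℕ) → Fintype (B n)
  | 0 => inferInstanceAs (Fintype Unit)
  | n + 1 => @instFintypeSum (B n) (B n) (instFintypeB n) (instFintypeB n)

noncomputable instance instDecB (n : ℕ) : DecidableEq (B n) := Classical.decEq _

def wt (l : ℕ → ℕ) : (n : ℕ) → B n → ℕ
  | 0, _ => 0
  | n + 1, s => Sum.elim (fun s => wt l n s) (fun s => wt l n s + l n) s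

def emp : (n : ℕ) → B n
  | 0 => ()
  | n + 1 => Sum.inl (emp n)

abbrev crd (n : ℕ) (s : B n) : ℕ := wt (fun _ => 1) n s

def inl {n : ℕ} (s : B n) : B (n + 1) := Sum.inl s
def inr {n : ℕ} (s : B n) : B (n + 1) := Sum.inr s

lemma B_ind {n : ℕ} {P : B (n + 1) → Prop} (h1 : ∀ s, P (inl s)) (h2 : ∀ s, P (inr s)) :
    ∀ s, P s := fun s => Sum.rec h1 h2 s

@[simp] lemma wt_inl (l : ℕ → ℕ) {n : ℕ} (s : B n) : wt l (n + 1) (inl s) = wt l n s := rfl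
@[simp] lemma wt_inr (l : ℕ → ℕ) {n : ℕ} (s : B n) : wt l (n + 1) (inr s) = wt l n s + l n := rfl
@[simp] lemma wt_emp (l : ℕ → ℕ) (n : ℕ) : wt l n (emp n) = 0 := by
  induction n with
  | zero => rfl
  | succ n ih => exact ih

lemma emp_succ (n : ℕ) : emp (n + 1) = inl (emp n) := rfl

lemma crd_eq_zero {n : ℕ} {s : B n} (h : crd n s = 0) : s = emp n := by
  induction n with
  | zero => rfl
  | succ n ih =>
    revert h
    refine B_ind (P := fun s => crd (n+1) s = 0 → s = emp (n+1)) ?_ ?_ s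
    · intro s h; rw [emp_succ, ih h]
    · intro s h; simp at h

variable {R : Type} [CommRing R]
set_option linter.unusedSectionVars false
set_option linter.unusedVariables false

def del (a : ℕ → R) : (n : ℕ) → (B n → R) → (B n → R)
  | 0, _ => 0
  | n + 1, f => Sum.elim
      (fun s => del a n (fun t => f (inl t)) s + a n * f (inr s))
      (fun s => - del a n (fun t => f (inr t)) s)

lemma del_inl (a : ℕ → R) {n : ℕ} (f : B (n + 1) → R) (s : B n) :
    del a (n + 1) f (inl s) = del a n (fun t => f (inl t)) s + a n * f (inr s) := rfl
lemma del_inr (a : ℕ → R) {n : ℕ} (f : B (n + 1) → R) (s : B n) :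
    del a (n + 1) f (inr s) = - del a n (fun t => f (inr t)) s := rfl

lemma del_add (a : ℕ → R) (n : ℕ) (f g : B n → R) : del a n (f + g) = del a n f + del a n g := by
  induction n with
  | zero => simp [del]
  | succ n ih =>
    funext s
    refine B_ind (P := fun s => del a (n+1) (f+g) s = (del a (n+1) f + del a (n+1) g) s) ?_ ?_ s
    · intro s
      have := congrFun (ih (fun t => f (inl t)) (fun t => g (inl t))) s
      simp only [Pi.add_apply, del_inl] at this ⊢
      rw [show (fun t => f (inl t) + g (inl t)) = (fun t => f (inl t)) + (fun t => g (inl t)) from rfl,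
        this]; ring
    · intro s
      have := congrFun (ih (fun t => f (inr t)) (fun t => g (inr t))) s
      simp only [Pi.add_apply, del_inr] at this ⊢
      rw [show (fun t => f (inr t) + g (inr t)) = (fun t => f (inr t)) + (fun t => g (inr t)) from rfl,
        this]; ring

lemma del_smul (a : ℕ → R) (n : ℕ) (c : R) (f : B n → R) : del a n (c • f) = c • del a n f := by
  induction n with
  | zero => simp [del]
  | succ n ih =>
    funext s
    refine B_ind (P := fun s => del a (n+1) (c • f) s = (c • del a (n+1) f) s) ?_ ?_ s
    · intro s
      have := congrFun (ih (fun t => f (inl t))) s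
      simp only [Pi.smul_apply, del_inl, smul_eq_mul] at this ⊢
      rw [show (fun t => c * f (inl t)) = c • (fun t => f (inl t)) from rfl,
        this]; ring
    · intro s
      have := congrFun (ih (fun t => f (inr t))) s
      simp only [Pi.smul_apply, del_inr, smul_eq_mul] at this ⊢
      rw [show (fun t => c * f (inr t)) = c • (fun t => f (inr t)) from rfl,
        this]; ring

/-- the Koszul differential as linear map -/
def dl (a : ℕ → R) (n : ℕ) : (B n → R) →ₗ[R] (B n → R) where
  toFun := del a n
  map_add' := del_add a n
  map_smul' := del_smul a n

lemma dl_inl (a : ℕ → R) {n : ℕ} (f : B (n + 1) → R) (s : B n) :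
    dl a (n + 1) f (inl s) = dl a n (fun t => f (inl t)) s + a n * f (inr s) := rfl
lemma dl_inr (a : ℕ → R) {n : ℕ} (f : B (n + 1) → R) (s : B n) :
    dl a (n + 1) f (inr s) = - dl a n (fun t => f (inr t)) s := rfl

lemma dl_inl' (a : ℕ → R) {n : ℕ} (f : B (n + 1) → R) :
    (fun s => dl a (n + 1) f (inl s)) = dl a n (fun t => f (inl t)) + a n • (fun s => f (inr s)) := rfl
lemma dl_inr' (a : ℕ → R) {n : ℕ} (f : B (n + 1) → R) :
    (fun s => dl a (n + 1) f (inr s)) = - dl a n (fun t => f (inr t)) := rfl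

lemma Bfun_ext {n : ℕ} {f g : B (n+1) → R} (h1 : (fun s => f (inl s)) = fun s => g (inl s))
    (h2 : (fun s => f (inr s)) = fun s => g (inr s)) : f = g := by
  funext s
  exact B_ind (P := fun s => f s = g s) (fun s => congrFun h1 s) (fun s => congrFun h2 s) s

lemma anti (a b : ℕ → R) (n : ℕ) (f : B n → R) : dl a n (dl b n f) = - dl b n (dl a n f) := by
  induction n with
  | zero => funext s; exact (neg_zero).symm
  | succ n ih =>
    apply Bfun_ext
    · rw [dl_inl', dl_inl', dl_inr']
      change _ = - (fun s => dl b (n+1) (dl a (n+1) f) (inl s))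
      rw [dl_inl', dl_inl', dl_inr', map_add, map_add, ih, map_smul, map_smul]
      module
    · rw [dl_inr', dl_inr']
      change _ = - (fun s => dl b (n+1) (dl a (n+1) f) (inr s))
      rw [dl_inr', dl_inr', map_neg, map_neg, ih]

lemma sq (a : ℕ → R) (n : ℕ) (f : B n → R) : dl a n (dl a n f) = 0 := by
  induction n with
  | zero => rfl
  | succ n ih =>
    apply Bfun_ext
    · rw [dl_inl', dl_inl', dl_inr', map_add, ih, map_smul]
      simp; rfl
    · rw [dl_inr', dl_inr', map_neg, ih]; simp; rfl

/-- homogeneous of exterior degree v -/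
def Hom (n v : ℕ) (f : B n → R) : Prop := ∀ s, crd n s ≠ v → f s = 0

lemma Hom.add {n v : ℕ} {f g : B n → R} (hf : Hom n v f) (hg : Hom n v g) : Hom n v (f + g) := by
  intro s hs; simp [hf s hs, hg s hs]
lemma Hom.sub {n v : ℕ} {f g : B n → R} (hf : Hom n v f) (hg : Hom n v g) : Hom n v (f - g) := by
  intro s hs; simp [hf s hs, hg s hs]
lemma Hom.neg {n v : ℕ} {f : B n → R} (hf : Hom n v f) : Hom n v (-f) := by
  intro s hs; simp [hf s hs]
lemma Hom.smul {n v : ℕ} {f : B n → R} (c : R) (hf : Hom n v f) : Hom n v (c • f) := by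
  intro s hs; simp [hf s hs]
lemma Hom.inl {n v : ℕ} {f : B (n+1) → R} (hf : Hom (n+1) v f) : Hom n v (fun s => f (inl s)) :=
  fun s hs => hf _ hs
lemma Hom.inr {n v : ℕ} {f : B (n+1) → R} (hf : Hom (n+1) (v+1) f) :
    Hom n v (fun s => f (inr s)) :=
  fun s hs => hf _ (by simpa using hs)
lemma Hom.zero_inr {n : ℕ} {f : B (n+1) → R} (hf : Hom (n+1) 0 f) :
    (fun s => f (EN.inr s)) = 0 := by
  funext s; exact hf _ (by simp)

/-- `x + e ∧ y` -/
def pr {n : ℕ} (x y : B n → R) : B (n+1) → R := Sum.elim x y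

lemma pr_inl {n : ℕ} (x y : B n → R) : (fun s => pr x y (inl s)) = x := rfl
lemma pr_inr {n : ℕ} (x y : B n → R) : (fun s => pr x y (inr s)) = y := rfl

lemma Hom_pr {n v : ℕ} {x y : B n → R} (hx : Hom n (v+1) x) (hy : Hom n v y) :
    Hom (n+1) (v+1) (pr x y) := by
  refine B_ind ?_ ?_
  · intro s hs; exact hx s hs
  · intro s hs; exact hy s (by simpa using hs)

lemma Hom_ext {n : ℕ} {f g : B n → R} (hf : Hom n 0 f) (hg : Hom n 0 g)
    (h : f (emp n) = g (emp n)) : f = g := by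
  funext s
  by_cases hs : crd n s = 0
  · rw [crd_eq_zero hs, h]
  · rw [hf s hs, hg s hs]

lemma Hom0_dl (a : ℕ → R) {n : ℕ} {g : B n → R} (h0 : Hom n 0 g) : dl a n g = 0 := by
  induction n with
  | zero => rfl
  | succ n ih =>
    apply Bfun_ext
    · rw [dl_inl', h0.zero_inr, ih h0.inl]; simp; rfl
    · rw [dl_inr', h0.zero_inr]; simp; rfl

lemma Hom_dl (a : ℕ → R) {n v : ℕ} {f : B n → R} (hf : Hom n (v+1) f) : Hom n v (dl a n f) := by
  induction n generalizing v with
  | zero => intro s _; rfl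
  | succ n ih =>
    refine B_ind ?_ ?_
    · intro s hs
      rw [dl_inl, ih hf.inl s hs, hf (inr s) (by simpa using hs)]; simp
    · intro s hs
      rw [dl_inr]
      cases v with
      | zero =>
        rw [Hom0_dl a hf.inr]; simp
      | succ v => rw [ih hf.inr s (by simpa using hs)]; simp

/-- Koszul condition -/
def KH (b : ℕ → R) (n : ℕ) : Prop := ∀ k < n, ∀ y : R,
  (∃ x, Hom k 1 x ∧ dl b k x (emp k) = b k * y) → ∃ x, Hom k 1 x ∧ dl b k x (emp k) = y

/-- membership in the ideal of minors -/
def InI (a b : ℕ → R) (n : ℕ) (y : R) : Prop :=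
  ∃ x, Hom n 2 x ∧ dl a n (dl b n x) (emp n) = y

def MH (a b : ℕ → R) (n : ℕ) : Prop := ∀ k < n, ∀ y : R,
  (∃ x, Hom k 1 x ∧ dl a k x (emp k) = a k * y ∧ dl b k x (emp k) = b k * y) → InI a b k y

theorem koszul (b : ℕ → R) {n : ℕ} (h : KH b n) (v : ℕ) (z : B n → R) (hz : Hom n (v+1) z)
    (hb : dl b n z = 0) : ∃ w, Hom n (v+2) w ∧ dl b n w = z := by
  induction n generalizing v with
  | zero => exact ⟨0, fun _ _ => rfl, by funext s; exact (hz s (by simp [wt])).symm⟩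
  | succ n ih =>
    have ih := ih (fun k hk => h k (by omega))
    have hy : dl b n (fun s => z (inr s)) = 0 := by
      have := dl_inr' b z
      rw [hb] at this
      exact neg_eq_zero.1 this.symm
    have hx : dl b n (fun s => z (inl s)) = - (b n • fun s => z (inr s)) := by
      have := dl_inl' b z
      rw [hb] at this
      exact eq_neg_of_add_eq_zero_left this.symm
    obtain ⟨w, hw, hwy⟩ : ∃ w, Hom n (v+1) w ∧ dl b n w = fun s => z (inr s) := by
      cases v with
      | zero =>
        obtain ⟨x, hx1, hx2⟩ := h n (by omega) (z (inr (emp n)))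
          ⟨- fun s => z (inl s), hz.inl.neg, by rw [map_neg, hx]; simp⟩
        exact ⟨x, hx1, Hom_ext (Hom_dl b hx1) hz.inr hx2⟩
      | succ v => exact ih v _ hz.inr hy
    obtain ⟨u, hu, hux⟩ := ih v ((fun s => z (inl s)) + b n • w) (hz.inl.add (hw.smul _)) (by
      rw [map_add, map_smul, hx, hwy]; simp)
    refine ⟨pr u (-w), Hom_pr hu hw.neg, Bfun_ext ?_ ?_⟩
    · rw [dl_inl', pr_inl, pr_inr, hux]; simp
    · rw [dl_inr', pr_inr, map_neg, hwy]; simp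

theorem star (a b : ℕ → R) {n : ℕ} (h : MH a b n) (v : ℕ) (z : B n → R) (hz : Hom n (v+1) z)
    (ha : dl a n z = 0) (hb : dl b n z = 0) : ∃ w, Hom n (v+3) w ∧ dl a n (dl b n w) = z := by
  induction n generalizing v with
  | zero => exact ⟨0, fun _ _ => rfl, by funext s; exact (hz s (by simp [wt])).symm⟩
  | succ n ih =>
    have ih := ih (fun k hk => h k (by omega))
    have hy : ∀ b, dl b (n+1) z = 0 → dl b n (fun s => z (inr s)) = 0 := by
      intro b hb
      have := dl_inr' b z
      rw [hb] at this
      exact neg_eq_zero.1 this.symm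
    have hx : ∀ b, dl b (n+1) z = 0 →
        dl b n (fun s => z (inl s)) = - (b n • fun s => z (inr s)) := by
      intro b hb
      have := dl_inl' b z
      rw [hb] at this
      exact eq_neg_of_add_eq_zero_left this.symm
    obtain ⟨w, hw, hwy⟩ : ∃ w, Hom n (v+2) w ∧ dl a n (dl b n w) = fun s => z (inr s) := by
      cases v with
      | zero =>
        obtain ⟨x, hx1, hx2⟩ := h n (by omega) (z (inr (emp n)))
          ⟨- fun s => z (inl s), hz.inl.neg, by rw [map_neg, hx a ha]; simp,
            by rw [map_neg, hx b hb]; simp⟩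
        exact ⟨x, hx1, Hom_ext (Hom_dl a (Hom_dl b hx1)) hz.inr hx2⟩
      | succ v => exact ih v _ hz.inr (hy a ha) (hy b hb)
    -- dl a (dl b (0,w)) = (b ∂a w - a ∂b w, ∂a∂b w)
    obtain ⟨u, hu, hux⟩ := ih v ((fun s => z (inl s)) - (b n • dl a n w - a n • dl b n w))
      (hz.inl.sub (((Hom_dl a hw).smul _).sub ((Hom_dl b hw).smul _))) (by
        rw [map_sub, map_sub, map_smul, map_smul, hx a ha, hwy, sq]; simp) (by
        rw [map_sub, map_sub, map_smul, map_smul, hx b hb, anti, hwy, sq]; simp)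
    refine ⟨pr u w, Hom_pr hu hw, Bfun_ext ?_ ?_⟩
    · rw [dl_inl', dl_inl', dl_inr', pr_inl, pr_inr, map_add, hux, map_smul]; module
    · rw [dl_inr', dl_inr', pr_inr, map_neg, hwy]; simp

theorem top (a b : ℕ → R) {n : ℕ} (h : MH a b n) (hk : KH b n) (v : ℕ) (z : B n → R)
    (hz : Hom n (v+2) z) (hab : dl a n (dl b n z) = 0) :
    ∃ w w', Hom n (v+3) w ∧ Hom n (v+3) w' ∧ dl a n w + dl b n w' = z := by
  obtain ⟨w, hw, hw2⟩ := star a b h v (dl b n z) (Hom_dl b hz) hab (sq _ _ _)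
  obtain ⟨w', hw', hw2'⟩ := koszul b hk (v+1) (z + dl a n w) (hz.add (Hom_dl a hw)) (by
    rw [map_add, anti b a, hw2]; simp)
  exact ⟨-w, w', hw.neg, hw', by rw [hw2', map_neg]; abel⟩

/-- exactness of the total complex -/
theorem total (a b : ℕ → R) {n : ℕ} (h : MH a b n) (hk : KH b n) (v i : ℕ) (z : ℕ → B n → R)
    (hz : ∀ u, Hom n (v+2) (z u)) (htop : dl a n (dl b n (z i)) = 0)
    (hc : ∀ u < i, dl a n (z (u+1)) + dl b n (z u) = 0) :
    ∃ w : ℕ → B n → R, (∀ u, Hom n (v+3) (w u)) ∧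
      ∀ u ≤ i, dl a n (w (u+1)) + dl b n (w u) = z u := by
  induction i generalizing z with
  | zero =>
    obtain ⟨w, w', hw, hw', e⟩ := top a b h hk v (z 0) (hz 0) htop
    refine ⟨fun u => if u = 0 then w' else w, fun u => by dsimp only; split_ifs <;> assumption, ?_⟩
    intro u hu
    obtain rfl : u = 0 := by omega
    simpa using e
  | succ i ih =>
    obtain ⟨w, hw, hwz⟩ := ih (fun u => z (u+1)) (fun u => hz _) htop
      (fun u hu => hc (u+1) (by omega))
    have h1 := hwz 0 (by omega)
    have h2 := hc 0 (by omega)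
    simp only [zero_add] at h1 h2
    obtain ⟨w', hw', e⟩ := koszul b hk (v+1) (z 0 - dl a n (w 0)) ((hz 0).sub (Hom_dl a (hw 0))) (by
      rw [map_sub, anti b a, sub_neg_eq_add, add_comm, ← h2, ← h1, map_add, sq, zero_add])
    refine ⟨fun u => Nat.casesOn u w' w, fun u => by cases u <;> simp [hw, hw'], ?_⟩
    intro u hu
    cases u with
    | zero => simp [e]
    | succ u => simpa using hwz u (by omega)

end EN


namespace EN

theorem build {K : Type} [Field K] {σ : Type} (I : Ideal (MvPolynomial σ K))
    {ι : ℕ → Type} [∀ i, Fintype (ι i)] [∀ i, DecidableEq (ι i)] (g : ∀ i, ι i → ℕ)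
    (D : ∀ i, (ι (i+1) → MvPolynomial σ K) →ₗ[MvPolynomial σ K] (ι i → MvPolynomial σ K))
    (ε : (ι 0 → MvPolynomial σ K) →ₗ[MvPolynomial σ K] MvPolynomial σ K)
    (hex : ∀ i z, D i z = 0 ↔ ∃ w, D (i+1) w = z)
    (h0 : ∀ z, ε z = 0 ↔ ∃ w, D 0 w = z)
    (hI : ∀ y, y ∈ I ↔ ∃ z, ε z = y)
    (hd : ∀ i k l, if g i l < g (i + 1) k
      then D i (Pi.single k 1) l ∈ homogeneousSubmodule σ K (g (i + 1) k - g i l)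
      else D i (Pi.single k 1) l = 0)
    (he : ∀ k, ε (Pi.single k 1) ∈ homogeneousSubmodule σ K (g 0 k))
    (p r : ℕ) (hp : ∀ i, Nonempty (ι i) ↔ i ≤ p) (hr1 : ∀ i k, g i k - i ≤ r)
    (hr2 : ∃ i k, g i k - i = r) :
    ∃ res : MinFreeResOfIdeal I, res.toMinFreeResData.pdim = (p : ℕ∞) ∧
        res.toMinFreeResData.reg = (r : ℕ∞) := by
  let e : ∀ i, ι i ≃ Fin (Fintype.card (ι i)) := fun i => Fintype.equivFin _
  let L : ∀ i, (Fin (Fintype.card (ι i)) → MvPolynomial σ K) ≃ₗ[MvPolynomial σ K]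
    (ι i → MvPolynomial σ K) := fun i => LinearEquiv.funCongrLeft _ _ (e i)
  have hL : ∀ i k, L i (Pi.single k 1) = Pi.single ((e i).symm k) 1 := by
    intro i k
    funext t
    simp only [L, LinearEquiv.funCongrLeft_apply, LinearMap.funLeft_apply, Pi.single_apply,
      Equiv.eq_symm_apply]
  have hLs : ∀ i z k, (L i).symm z k = z ((e i).symm k) := by
    intro i z k
    obtain ⟨z, rfl⟩ := (L i).surjective z
    rw [LinearEquiv.symm_apply_apply]
    simp [L, LinearMap.funLeft_apply]
  let res : MinFreeResOfIdeal I :=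
    { N := fun i => Fintype.card (ι i)
      g := fun i k => g i ((e i).symm k)
      d := fun i => ((L i).symm.toLinearMap ∘ₗ D i) ∘ₗ (L (i+1)).toLinearMap
      hexact := by
        intro i
        ext x
        simp only [LinearMap.mem_range, LinearMap.mem_ker, LinearMap.comp_apply,
          LinearEquiv.coe_coe, LinearEquiv.map_eq_zero_iff, hex]
        constructor
        · rintro ⟨y, rfl⟩; exact ⟨_, (LinearEquiv.apply_symm_apply _ _).symm⟩
        · rintro ⟨w, hw⟩; exact ⟨(L (i+1+1)).symm w, by simp [hw]⟩
      hdeg := by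
        intro i k l
        simp only [LinearMap.comp_apply, LinearEquiv.coe_coe, hL, hLs]
        exact hd _ _ _
      ε := ε ∘ₗ (L 0).toLinearMap
      hrange := by
        ext x
        simp only [LinearMap.mem_range, LinearMap.comp_apply, LinearEquiv.coe_coe]
        refine Iff.trans ?_ (hI x).symm
        constructor
        · rintro ⟨y, rfl⟩; exact ⟨_, rfl⟩
        · rintro ⟨w, hw⟩; exact ⟨(L 0).symm w, by simp [hw]⟩
      hker := by
        ext x
        simp only [LinearMap.mem_range, LinearMap.mem_ker, LinearMap.comp_apply,
          LinearEquiv.coe_coe, h0]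
        constructor
        · rintro ⟨w, hw⟩; exact ⟨(L (0+1)).symm w, by simp [hw]⟩
        · rintro ⟨y, rfl⟩; exact ⟨_, (LinearEquiv.apply_symm_apply _ _).symm⟩
      hεdeg := by
        intro k
        simp only [LinearMap.comp_apply, LinearEquiv.coe_coe, hL]
        exact he _ }
  have hb : ∀ i j, res.toMinFreeResData.betti i j ≠ 0 ↔ ∃ k, g i k = j := by
    intro i j
    rw [MinFreeResData.betti, Finset.card_ne_zero]
    constructor
    · rintro ⟨k, hk⟩
      exact ⟨_, (Finset.mem_filter.1 hk).2⟩
    · rintro ⟨k, hk⟩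
      exact ⟨e i k, Finset.mem_filter.2 ⟨Finset.mem_univ _, by
        change g i ((e i).symm (e i k)) = j
        simpa using hk⟩⟩
  refine ⟨res, le_antisymm ?_ ?_, le_antisymm ?_ ?_⟩
  · apply sSup_le
    rintro _ ⟨i, ⟨j, hj⟩, rfl⟩
    obtain ⟨k, -⟩ := (hb i j).1 hj
    exact Nat.cast_le.2 ((hp i).1 ⟨k⟩)
  · obtain ⟨k⟩ := (hp p).2 le_rfl
    exact le_sSup ⟨p, ⟨_, (hb _ _).2 ⟨k, rfl⟩⟩, rfl⟩
  · apply sSup_le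
    rintro _ ⟨⟨i, j⟩, hj, rfl⟩
    obtain ⟨k, rfl⟩ := (hb i j).1 hj
    exact Nat.cast_le.2 (hr1 i k)
  · obtain ⟨i, k, hk⟩ := hr2
    exact le_sSup ⟨(i, g i k), (hb _ _).2 ⟨k, rfl⟩, by simp only [hk]⟩

abbrev Ix (n i : ℕ) : Type := Fin (i+1) × {s : B n // crd n s = i+2}

section
variable {R : Type} [CommRing R]
set_option linter.unusedSectionVars false
set_option linter.unusedVariables false

def sl (n i u : ℕ) : (Ix n i → R) →ₗ[R] (B n → R) where
  toFun z s := if h : u < i+1 ∧ crd n s = i+2 then z (⟨u, h.1⟩, ⟨s, h.2⟩) else 0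
  map_add' x y := by
    funext s
    dsimp only [Pi.add_apply]
    split_ifs <;> simp
  map_smul' c x := by
    funext s
    dsimp only [Pi.smul_apply, RingHom.id_apply]
    split_ifs <;> simp

lemma sl_apply (n i u : ℕ) (z : Ix n i → R) (s : B n) :
  sl n i u z s = if h : u < i+1 ∧ crd n s = i+2 then z (⟨u, h.1⟩, ⟨s, h.2⟩) else 0 := rfl

lemma Hom_sl (n i u : ℕ) (z : Ix n i → R) : Hom n (i+2) (sl n i u z) := by
  intro s hs
  rw [sl_apply, dif_neg (fun h => hs h.2)]

def pk (n i : ℕ) (w : ℕ → B n → R) : Ix n i → R := fun k => w k.1 k.2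

lemma sl_pk (n i u : ℕ) (hu : u < i + 1) (w : ℕ → B n → R) (hw : Hom n (i+2) (w u)) :
    sl n i u (pk n i w) = w u := by
  funext s
  rw [sl_apply]
  split_ifs with h
  · rfl
  · exact (hw s (fun h' => h ⟨hu, h'⟩)).symm

lemma pk_sl (n i : ℕ) (z : Ix n i → R) : pk n i (fun u => sl n i u z) = z := by
  funext k
  obtain ⟨u, s⟩ := k
  simp only [pk, sl_apply]
  rw [dif_pos ⟨u.2, s.2⟩]

def DD (a b : ℕ → R) (n i : ℕ) : (Ix n (i+1) → R) →ₗ[R] (Ix n i → R) where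
  toFun z := pk n i (fun u => dl a n (sl n (i+1) (u+1) z) + dl b n (sl n (i+1) u z))
  map_add' x y := by
    funext k
    simp only [pk, map_add, Pi.add_apply]; abel
  map_smul' c x := by
    funext k
    simp only [pk, map_smul, Pi.smul_apply, Pi.add_apply, smul_eq_mul, RingHom.id_apply]; ring

lemma sl_DD (a b : ℕ → R) (n i u : ℕ) (hu : u < i+1) (z : Ix n (i+1) → R) :
    sl n i u (DD a b n i z) = dl a n (sl n (i+1) (u+1) z) + dl b n (sl n (i+1) u z) :=
  sl_pk n i u hu (fun u => dl a n (sl n (i+1) (u+1) z) + dl b n (sl n (i+1) u z)) ((Hom_dl a (Hom_sl _ _ _ _)).add (Hom_dl b (Hom_sl _ _ _ _)))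

lemma sl_ext {n i : ℕ} {z z' : Ix n i → R} (h : ∀ u < i+1, sl n i u z = sl n i u z') : z = z' := by
  rw [← pk_sl n i z, ← pk_sl n i z']
  funext k
  simp only [pk]
  rw [h _ k.1.2]

lemma DD_exact (a b : ℕ → R) (n : ℕ) (h : MH a b n) (hk : KH b n) (i : ℕ) (z : Ix n (i+1) → R) :
    DD a b n i z = 0 ↔ ∃ w, DD a b n (i+1) w = z := by
  constructor
  · intro hz
    have hc : ∀ u < i+1, dl a n (sl n (i+1) (u+1) z) + dl b n (sl n (i+1) u z) = 0 := by
      intro u hu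
      rw [← sl_DD a b n i u hu, hz, map_zero]
    obtain ⟨w, hw, hwz⟩ := total a b h hk (i+1) (i+1) (fun u => sl n (i+1) u z)
      (fun u => Hom_sl _ _ _ _) (by
        have := hc i (by omega)
        rw [anti, eq_neg_of_add_eq_zero_left this, map_neg, sq]; simp) hc
    refine ⟨pk n (i+2) w, sl_ext ?_⟩
    intro u hu
    rw [sl_DD _ _ _ _ _ hu, sl_pk _ _ _ (by omega) _ (hw _), sl_pk _ _ _ (by omega) _ (hw _)]
    exact hwz u (by omega)
  · rintro ⟨w, rfl⟩
    apply sl_ext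
    intro u hu
    rw [sl_DD _ _ _ _ _ hu, sl_DD _ _ _ _ _ (by omega), sl_DD _ _ _ _ _ (by omega), map_add,
      map_add, sq, sq, anti a b]
    simp

def EE (a b : ℕ → R) (n : ℕ) : (Ix n 0 → R) →ₗ[R] R :=
  LinearMap.proj (emp n) ∘ₗ dl a n ∘ₗ dl b n ∘ₗ sl n 0 0

lemma EE_apply (a b : ℕ → R) (n : ℕ) (z : Ix n 0 → R) :
    EE a b n z = dl a n (dl b n (sl n 0 0 z)) (emp n) := rfl

lemma EE_exact (a b : ℕ → R) (n : ℕ) (h : MH a b n) (hk : KH b n) (z : Ix n 0 → R) :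
    EE a b n z = 0 ↔ ∃ w, DD a b n 0 w = z := by
  constructor
  · intro hz
    obtain ⟨w, hw, hwz⟩ := total a b h hk 0 0 (fun u => sl n 0 u z)
      (fun u => Hom_sl _ _ _ _) (Hom_ext (Hom_dl a (Hom_dl b (Hom_sl _ _ _ _)))
        (fun _ _ => rfl) hz) (fun u hu => by omega)
    refine ⟨pk n 1 w, sl_ext ?_⟩
    intro u hu
    rw [sl_DD _ _ _ _ _ hu, sl_pk _ _ _ (by omega) _ (hw _), sl_pk _ _ _ (by omega) _ (hw _)]
    exact hwz u (by omega)
  · rintro ⟨w, rfl⟩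
    rw [EE_apply, sl_DD _ _ _ _ _ (by omega), map_add, sq, add_zero, anti, sq]
    simp

lemma EE_range (a b : ℕ → R) (n : ℕ) (y : R) : InI a b n y ↔ ∃ z, EE a b n z = y := by
  constructor
  · rintro ⟨x, hx, rfl⟩
    refine ⟨pk n 0 (fun _ => x), ?_⟩
    rw [EE_apply, sl_pk _ _ _ (by omega) _ hx]
  · rintro ⟨z, rfl⟩
    exact ⟨_, Hom_sl _ _ _ _, rfl⟩

lemma sl_single (n i u : ℕ) (k : Ix n i) :
    sl n i u (Pi.single k (1 : R)) = 0 ∨ sl n i u (Pi.single k (1 : R)) = Pi.single k.2.1 1 := by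
  obtain ⟨v, s⟩ := k
  by_cases h : u = v
  · right
    funext t
    rw [sl_apply]
    by_cases ht : t = s.1
    · subst ht; subst h
      rw [dif_pos ⟨v.2, s.2⟩]; simp
    · rw [Pi.single_eq_of_ne ht]
      split_ifs with h'
      · rw [Pi.single_eq_of_ne]
        intro e
        apply ht
        have := congrArg (fun x => x.2.1) e
        exact this
      · rfl
  · left
    funext t
    rw [sl_apply]
    split_ifs with h'
    · rw [Pi.single_eq_of_ne]; rfl
      intro e
      apply h
      have := congrArg (fun x => x.1.1) e
      exact this
    · rfl
end

section
variable {K : Type} [Field K] {σ : Type}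

def WH (l : ℕ → ℕ) (c n w : ℕ) (f : B n → MvPolynomial σ K) : Prop :=
  ∀ s, f s = 0 ∨ ∃ k, c ≤ k ∧ wt l n s + k = w ∧ f s ∈ homogeneousSubmodule σ K k

lemma or_add {P : ℕ → Prop} (hP : ∀ k k', P k → P k' → k = k') {x y : MvPolynomial σ K}
    (hx : x = 0 ∨ ∃ k, P k ∧ x ∈ homogeneousSubmodule σ K k)
    (hy : y = 0 ∨ ∃ k, P k ∧ y ∈ homogeneousSubmodule σ K k) :
    x + y = 0 ∨ ∃ k, P k ∧ x + y ∈ homogeneousSubmodule σ K k := by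
  rcases hx with rfl | ⟨k, hk, hx⟩
  · simpa using hy
  · rcases hy with rfl | ⟨k', hk', hy⟩
    · right; exact ⟨k, hk, by simpa using hx⟩
    · obtain rfl := hP _ _ hk hk'
      right; exact ⟨k, hk, add_mem hx hy⟩

lemma WH.add {l : ℕ → ℕ} {c n w : ℕ} {f g : B n → MvPolynomial σ K} (hf : WH l c n w f)
    (hg : WH l c n w g) : WH l c n w (f + g) := by
  intro s
  have := or_add (P := fun k => c ≤ k ∧ wt l n s + k = w) (by intros; omega)
    (by simpa only [and_assoc] using hf s) (by simpa only [and_assoc] using hg s)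
  simpa only [and_assoc, Pi.add_apply] using this

lemma WH_zero (l : ℕ → ℕ) (c n w : ℕ) : WH l c n w (0 : B n → MvPolynomial σ K) :=
  fun _ => Or.inl rfl

lemma WH_dl {l : ℕ → ℕ} {a : ℕ → MvPolynomial σ K} {n w : ℕ}
    (ha : ∀ k < n, 0 < l k ∧ a k ∈ homogeneousSubmodule σ K (l k))
    {f : B n → MvPolynomial σ K} (hf : WH l 0 n w f) :
    WH l 1 n w (dl a n f) := by
  induction n generalizing w with
  | zero => exact fun _ => Or.inl rfl
  | succ n ih =>
    refine B_ind ?_ ?_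
    · intro s
      have h1 : WH l 1 n w (dl a n (fun t => f (inl t))) := ih (fun k hk => ha k (by omega))
        (fun s => hf (inl s))
      have h2 : WH l 1 n w (fun s => a n * f (inr s)) := by
        intro s
        rcases hf (inr s) with h | ⟨k, -, hk, h⟩
        · left; simp [h]
        · right
          have := ha n (by omega)
          refine ⟨l n + k, by omega, ?_, IsHomogeneous.mul this.2 h⟩
          rw [wt_inr] at hk; omega
      exact h1.add h2 s
    · intro s
      have h1 : WH l 1 n (w - l n) (dl a n (fun t => f (inr t))) ∨ w < l n ∧ (fun t => f (inr t)) = 0 := by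
        by_cases hw : l n ≤ w
        · left
          apply ih (fun k hk => ha k (by omega))
          intro s
          rcases hf (inr s) with h | ⟨k, -, hk, h⟩
          · left; exact h
          · right; rw [wt_inr] at hk; exact ⟨k, by omega, by omega, h⟩
        · right
          refine ⟨by omega, ?_⟩
          funext s
          rcases hf (inr s) with h | ⟨k, -, hk, h⟩
          · exact h
          · rw [wt_inr] at hk; omega
      rw [dl_inr]
      rcases h1 with h1 | ⟨h1, h2⟩
      · rcases h1 s with h | ⟨k, hc, hk, h⟩
        · left; simp [h]
        · right; exact ⟨k, hc, by rw [wt_inr]; have := (ha n (by omega)).1; omega, neg_mem h⟩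
      · left; simp [h2]

lemma WH.weak {l : ℕ → ℕ} {n w : ℕ} {f : B n → MvPolynomial σ K} (hf : WH l 1 n w f) :
    WH l 0 n w f := by
  intro s
  rcases hf s with h | ⟨k, h1, h2⟩
  · exact Or.inl h
  · exact Or.inr ⟨k, by omega, h2⟩

lemma WH_sl (l : ℕ → ℕ) (n i u : ℕ) (k : Ix n i) :
    WH l 0 n (wt l n k.2.1) (sl n i u (Pi.single k (1 : MvPolynomial σ K))) := by
  rcases sl_single (R := MvPolynomial σ K) n i u k with h | h <;> rw [h]
  · exact WH_zero _ _ _ _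
  · intro s
    by_cases hs : s = k.2.1
    · subst hs
      right; exact ⟨0, le_rfl, rfl, by rw [Pi.single_eq_same]; exact isHomogeneous_one σ K⟩
    · left; exact Pi.single_eq_of_ne hs _

theorem resolution (I : Ideal (MvPolynomial σ K)) (a b : ℕ → MvPolynomial σ K) (l : ℕ → ℕ) (n : ℕ)
    (h : MH a b n) (hk : KH b n) (hI : ∀ y, y ∈ I ↔ InI a b n y)
    (ha : ∀ k < n, 0 < l k ∧ a k ∈ homogeneousSubmodule σ K (l k))
    (hb : ∀ k < n, 0 < l k ∧ b k ∈ homogeneousSubmodule σ K (l k))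
    (p r : ℕ) (hp : ∀ i, (∃ s, crd n s = i+2) ↔ i ≤ p)
    (hr1 : ∀ i s, crd n s = i+2 → wt l n s - i ≤ r)
    (hr2 : ∃ i s, crd n s = i+2 ∧ wt l n s - i = r) :
    ∃ res : MinFreeResOfIdeal I, res.toMinFreeResData.pdim = (p : ℕ∞) ∧
        res.toMinFreeResData.reg = (r : ℕ∞) := by
  refine build I (ι := fun i => Ix n i) (fun i k => wt l n k.2.1) (fun i => DD a b n i) (EE a b n)
    (fun i z => DD_exact a b n h hk i z) (EE_exact a b n h hk)
    (fun y => (hI y).trans (EE_range a b n y)) ?_ ?_ p r ?_ ?_ ?_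
  · intro i k t
    have := ((WH_dl ha (WH_sl l n (i+1) (t.1+1) k)).add (WH_dl hb (WH_sl l n (i+1) t.1 k))) t.2.1
    have e : DD a b n i (Pi.single k 1) t = (dl a n (sl n (i+1) (t.1+1) (Pi.single k 1))
      + dl b n (sl n (i+1) t.1 (Pi.single k 1))) t.2.1 := rfl
    split_ifs with hlt
    · rcases this with h | ⟨j, hj, hj2, h⟩
      · rw [e, h]; exact zero_mem _
      · obtain rfl : wt l n k.2.1 - wt l n t.2.1 = j := by omega
        exact h
    · rcases this with h | ⟨j, hj, hj2, h⟩
      · exact h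
      · omega
  · intro k
    have := WH_dl ha (WH_dl hb (WH_sl l n 0 0 k)).weak (emp n)
    rcases this with h | ⟨j, hj, hj2, h⟩
    · rw [EE_apply, h]; exact zero_mem _
    · rw [wt_emp, zero_add] at hj2
      subst hj2
      exact h
  · intro i
    rw [← hp i]
    constructor
    · rintro ⟨k⟩; exact ⟨k.2.1, k.2.2⟩
    · rintro ⟨s, hs⟩; exact ⟨(0, ⟨s, hs⟩)⟩
  · intro i k; exact hr1 i _ k.2.2
  · obtain ⟨i, s, hs, e⟩ := hr2
    exact ⟨i, (0, ⟨s, hs⟩), e⟩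
end
end EN


namespace EN

section
variable {R : Type} [CommRing R]

def J (a b : ℕ → R) (k : ℕ) : Ideal R :=
  Ideal.span {x | ∃ i < k, ∃ j < k, x = a i * b j - a j * b i}

lemma J_gen (a b : ℕ → R) {k i j : ℕ} (hi : i < k) (hj : j < k) : a i * b j - a j * b i ∈ J a b k :=
  Ideal.subset_span ⟨i, hi, j, hj, rfl⟩

lemma J_mono (a b : ℕ → R) {k k' : ℕ} (h : k ≤ k') : J a b k ≤ J a b k' := by
  apply Ideal.span_mono
  rintro x ⟨i, hi, j, hj, rfl⟩
  exact ⟨i, by omega, j, by omega, rfl⟩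

lemma cross_mem (a b : ℕ → R) {k m i : ℕ} (hm : m ≤ k) (hi : i < k) (x : B m → R) :
    a i * dl b m x (emp m) - b i * dl a m x (emp m) ∈ J a b k := by
  induction m with
  | zero =>
    have : ∀ c : ℕ → R, dl c 0 x (emp 0) = 0 := fun _ => rfl
    simp [this]
  | succ m ih =>
    rw [emp_succ, dl_inl, dl_inl]
    have h1 := ih (by omega) (fun t => x (inl t))
    have h2 := Ideal.mul_mem_right (x (inr (emp m))) _ (J_gen a b (k := k) hi (show m < k by omega))
    convert add_mem h1 h2 using 1
    ring

lemma InI_J (a b : ℕ → R) (k : ℕ) (x : B k → R) : dl a k (dl b k x) (emp k) ∈ J a b k := by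
  induction k with
  | zero =>
    have : dl a 0 (dl b 0 x) (emp 0) = 0 := rfl
    simp [this]
  | succ k ih =>
    rw [emp_succ, dl_inl, dl_inl', dl_inr, map_add, map_smul]
    simp only [Pi.add_apply, Pi.smul_apply, smul_eq_mul]
    have h1 := J_mono a b (Nat.le_succ k) (ih (fun t => x (inl t)))
    have h2 := cross_mem a b (show k ≤ k+1 by omega) (show k < k+1 by omega) (fun t => x (inr t))
    convert sub_mem h1 h2 using 1
    ring

lemma unit_vec (k i : ℕ) (hi : i < k) :
    ∃ y : B k → R, Hom k 1 y ∧ ∀ c : ℕ → R, dl c k y (emp k) = c i := by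
  induction k with
  | zero => omega
  | succ k ih =>
    by_cases h : i = k
    · subst h
      refine ⟨pr 0 (Pi.single (emp i) 1), Hom_pr (fun _ _ => rfl) ?_, ?_⟩
      · intro s hs
        apply Pi.single_eq_of_ne
        rintro rfl; simp at hs
      · intro c
        rw [emp_succ, dl_inl, pr_inl]
        change dl c i 0 (emp i) + c i * (Pi.single (emp i) (1:R) : B i → R) (emp i) = c i
        simp
    · obtain ⟨y, hy, hc⟩ := ih (by omega)
      refine ⟨pr y 0, Hom_pr hy (fun _ _ => rfl), ?_⟩
      intro c
      rw [emp_succ, dl_inl, pr_inl, hc]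
      change c i + c k * 0 = c i
      simp

lemma dl_span (b : ℕ → R) (k : ℕ) (x : B k → R) :
    dl b k x (emp k) ∈ Ideal.span (b '' {i | i < k}) := by
  induction k with
  | zero =>
    have : dl b 0 x (emp 0) = 0 := rfl
    simp [this]
  | succ k ih =>
    rw [emp_succ, dl_inl]
    refine add_mem (Ideal.span_mono (Set.image_mono (fun i (hi : i < k) => ?_)) (ih _))
      (Ideal.mul_mem_right _ _ (Ideal.subset_span ⟨k, by simp, rfl⟩))
    show i < k + 1
    omega

lemma span_dl (b : ℕ → R) (k : ℕ) (y : R) (hy : y ∈ Ideal.span (b '' {i | i < k})) :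
    ∃ x, Hom k 1 x ∧ dl b k x (emp k) = y := by
  induction hy using Submodule.span_induction with
  | mem x hx =>
    obtain ⟨i, hi, rfl⟩ := hx
    obtain ⟨y, hy, hc⟩ := unit_vec (R := R) k i hi
    exact ⟨y, hy, hc b⟩
  | zero => exact ⟨0, fun _ _ => rfl, by simp⟩
  | add x y _ _ hx hy =>
    obtain ⟨u, hu, rfl⟩ := hx
    obtain ⟨v, hv, rfl⟩ := hy
    exact ⟨u + v, hu.add hv, by simp⟩
  | smul c x _ hx =>
    obtain ⟨u, hu, rfl⟩ := hx
    exact ⟨c • u, hu.smul c, by simp⟩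

lemma InI_succ (a b : ℕ → R) {k : ℕ} {y : R} (h : InI a b k y) : InI a b (k+1) y := by
  obtain ⟨x, hx, rfl⟩ := h
  refine ⟨pr x 0, Hom_pr hx (fun _ _ => rfl), ?_⟩
  rw [emp_succ, dl_inl, dl_inl', dl_inr, pr_inl, pr_inr]
  simp

lemma InI_neg (a b : ℕ → R) {k : ℕ} {y : R} (h : InI a b k y) : InI a b k (-y) := by
  obtain ⟨x, hx, rfl⟩ := h
  exact ⟨-x, hx.neg, by simp⟩

lemma InI_last (a b : ℕ → R) {k i : ℕ} (hi : i < k) : InI a b (k+1) (a i * b k - a k * b i) := by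
  obtain ⟨y, hy, hc⟩ := unit_vec (R := R) k i hi
  refine ⟨pr 0 y, Hom_pr (fun _ _ => rfl) hy, ?_⟩
  rw [emp_succ, dl_inl, dl_inl', dl_inr, pr_inl, pr_inr, map_add, map_smul]
  simp only [Pi.add_apply, Pi.smul_apply, smul_eq_mul, hc, map_zero, Pi.zero_apply]
  ring

lemma InI_gen (a b : ℕ → R) {k i j : ℕ} (hi : i < k) (hj : j < k) :
    InI a b k (a i * b j - a j * b i) := by
  induction k with
  | zero => omega
  | succ k ih =>
    by_cases h1 : i < k
    · by_cases h2 : j < k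
      · exact InI_succ a b (ih h1 h2)
      · obtain rfl : j = k := by omega
        exact InI_last a b h1
    · obtain rfl : i = k := by omega
      by_cases h2 : j < i
      · have := InI_neg a b (InI_last a b h2)
        rwa [neg_sub] at this
      · obtain rfl : j = i := by omega
        exact ⟨0, fun _ _ => rfl, by simp⟩

lemma InI_iff (a b : ℕ → R) (k : ℕ) (y : R) : InI a b k y ↔ y ∈ J a b k := by
  constructor
  · rintro ⟨x, -, rfl⟩; exact InI_J a b k x
  · intro hy
    unfold J at hy
    induction hy using Submodule.span_induction with
    | mem x hx =>
      obtain ⟨i, hi, j, hj, rfl⟩ := hx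
      exact InI_gen a b hi hj
    | zero => exact ⟨0, fun _ _ => rfl, by simp⟩
    | add x y _ _ hx hy =>
      obtain ⟨u, hu, rfl⟩ := hx
      obtain ⟨v, hv, rfl⟩ := hy
      exact ⟨u + v, hu.add hv, by simp⟩
    | smul c x _ hx =>
      obtain ⟨u, hu, rfl⟩ := hx
      exact ⟨c • u, hu.smul c, by simp⟩
end

section
variable {K : Type} [Field K] {σ : Type}

/-- kernel of a monomial map -/
theorem ker_le {W : Type} (w : σ → W →₀ ℕ) (φ : MvPolynomial σ K →ₐ[K] MvPolynomial W K)
    (hφ : ∀ e, φ (X e) = monomial (w e) 1) (I : Ideal (MvPolynomial σ K))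
    (h : ∀ m m' : σ →₀ ℕ, (m.sum fun e c => c • w e) = (m'.sum fun e c => c • w e) →
      (monomial m (1 : K) - monomial m' 1) ∈ I) (y : MvPolynomial σ K) (hy : φ y = 0) : y ∈ I := by
  classical
  have hm : ∀ m : σ →₀ ℕ, φ (monomial m 1) = monomial (m.sum fun e c => c • w e) 1 := by
    intro m
    rw [monomial_eq, map_mul, Finsupp.prod, map_prod, C_1, map_one, one_mul, Finsupp.sum,
      monomial_sum_one]
    refine Finset.prod_congr rfl fun e _ => ?_
    rw [map_pow, hφ, monomial_pow, one_pow]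
  let rep : (W →₀ ℕ) → (σ →₀ ℕ) := fun t =>
    if h : ∃ m : σ →₀ ℕ, (m.sum fun e c => c • w e) = t then h.choose else 0
  have hrep : ∀ m : σ →₀ ℕ,
      ((rep (m.sum fun e c => c • w e)).sum fun e c => c • w e) = (m.sum fun e c => c • w e) := by
    intro m
    have h : ∃ m' : σ →₀ ℕ, (m'.sum fun e c => c • w e) = (m.sum fun e c => c • w e) := ⟨m, rfl⟩
    simp only [rep, dif_pos h]
    exact h.choose_spec
  let ρ : MvPolynomial W K →ₗ[K] MvPolynomial σ K :=
    (basisMonomials W K).constr K (fun t => monomial (rep t) (1 : K))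
  have hρ : ∀ t, ρ (monomial t 1) = monomial (rep t) 1 := by
    intro t
    have := (basisMonomials W K).constr_basis K (fun t => monomial (rep t) (1 : K)) t
    simpa [ρ] using this
  have key : ∀ y : MvPolynomial σ K, y - ρ (φ y) ∈ I := by
    intro y
    induction y using MvPolynomial.monomial_add_induction_on with
    | C c =>
      have : (C c : MvPolynomial σ K) = c • monomial 0 1 := by rw [C_apply, smul_monomial, smul_eq_mul, mul_one]
      rw [this, map_smul, map_smul, hm, hρ, ← smul_sub, smul_eq_C_mul]
      exact Ideal.mul_mem_left _ _ (h _ _ (hrep 0).symm)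
    | monomial_add m c f _ _ hf =>
      have : (monomial m c : MvPolynomial σ K) = c • monomial m 1 := by simp [smul_monomial]
      have h1 : monomial m c - ρ (φ (monomial m c)) ∈ I := by
        rw [this, map_smul, map_smul, hm, hρ, ← smul_sub, smul_eq_C_mul]
        exact Ideal.mul_mem_left _ _ (h _ _ (hrep m).symm)
      rw [map_add, map_add, add_sub_add_comm]
      exact add_mem h1 hf
  have := key y
  rwa [hy, map_zero, sub_zero] at this

variable [Fintype σ] (col : σ → ℕ) (sg : σ → Bool)

noncomputable def Ex (β : Bool) (i : ℕ) : σ →₀ ℕ :=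
  Finsupp.equivFunOnFinite.symm (fun e => if col e = i ∧ sg e = β then 1 else 0)

lemma Ex_apply (β : Bool) (i : ℕ) (e : σ) :
    Ex col sg β i e = if col e = i ∧ sg e = β then 1 else 0 := rfl

variable (K) in
noncomputable def mo (β : Bool) (i : ℕ) : MvPolynomial σ K := monomial (Ex col sg β i) 1

theorem comb (k : ℕ) (N : ℕ) : ∀ (m m' : σ →₀ ℕ) (δ : ℕ → ℤ),
    (∀ i, k ≤ i → δ i = 0) → (∑ i ∈ Finset.range k, δ i = 0) →
    (∑ i ∈ Finset.range k, (δ i).natAbs = N) →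
    (∀ e, (m' e : ℤ) = m e + δ (col e) * (if sg e = true then 1 else -1)) →
    (monomial m (1 : K) - monomial m' 1) ∈ J (mo K col sg true) (mo K col sg false) k := by
  induction N using Nat.strong_induction_on with
  | _ N ih =>
  intro m m' δ h0 hs hN hm
  by_cases hz : ∃ i ∈ Finset.range k, δ i ≠ 0
  · obtain ⟨i, hi, hi0⟩ := Finset.exists_pos_of_sum_zero_of_exists_nonzero δ hs hz
    obtain ⟨j, hj, hj0⟩ := Finset.exists_pos_of_sum_zero_of_exists_nonzero (s := Finset.range k) (fun i => - δ i)
      (by simp [hs]) (by simpa using hz)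
    have hij : i ≠ j := by rintro rfl; omega
    rw [Finset.mem_range] at hi hj
    have hle : Ex col sg false i + Ex col sg true j ≤ m := by
      intro e
      have := hm e
      simp only [Finsupp.add_apply, Ex_apply]
      by_cases h1 : col e = i
      · rw [h1] at this ⊢
        cases hse : sg e <;> simp [hse, hij] at this ⊢
        omega
      · by_cases h2 : col e = j
        · rw [h2] at this ⊢
          cases hse : sg e <;> simp [hse, hij.symm] at this ⊢
          omega
        · simp [h1, h2]
    obtain ⟨q, hq⟩ := exists_add_of_le hle
    set m1 := Ex col sg true i + Ex col sg false j + q with hm1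
    have e1 : (monomial m (1 : K) - monomial m1 1) ∈
        J (mo K col sg true) (mo K col sg false) k := by
      have := Ideal.mul_mem_right (monomial q (1 : K)) _
        (J_gen (mo K col sg true) (mo K col sg false) hj hi)
      convert this using 1
      rw [sub_mul, hq, hm1]
      simp only [mo, monomial_mul, mul_one]
      rw [add_comm (Ex col sg false i)]
    have e2 : (monomial m1 (1 : K) - monomial m' 1) ∈
        J (mo K col sg true) (mo K col sg false) k := by
      refine ih (∑ t ∈ Finset.range k,
        (δ t - (if t = i then 1 else 0) + (if t = j then 1 else 0)).natAbs) ?_ m1 m'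
        (fun t => δ t - (if t = i then 1 else 0) + (if t = j then 1 else 0)) ?_ ?_ rfl ?_
      · rw [← hN]
        apply Finset.sum_lt_sum
        · intro t ht
          split_ifs with h1 h2 h2
          · omega
          · subst h1; omega
          · subst h2; omega
          · omega
        · refine ⟨i, Finset.mem_range.2 hi, ?_⟩
          simp only [if_true, if_neg hij]
          omega
      · intro t ht
        rw [if_neg (by omega), if_neg (by omega), h0 t ht]; rfl
      · rw [Finset.sum_add_distrib, Finset.sum_sub_distrib, hs, Finset.sum_ite_eq',
          Finset.sum_ite_eq']
        simp [hi, hj]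
      · intro e
        have h1 := hm e
        have h2 := DFunLike.congr_fun hq e
        rw [hm1]
        simp only [Finsupp.add_apply, Ex_apply] at h2 ⊢
        rw [h1, h2]
        push_cast
        by_cases h3 : col e = i
        · rw [h3]
          cases hse : sg e <;> simp [hij] <;> ring
        · by_cases h4 : col e = j
          · rw [h4]
            cases hse : sg e <;> simp [hij.symm] <;> ring
          · simp [h3, h4]
    have := add_mem e1 e2
    rwa [sub_add_sub_cancel] at this
  · push Not at hz
    have : m = m' := by
      ext e
      have h1 := hm e
      have : δ (col e) = 0 := by
        by_cases hk : k ≤ col e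
        · exact h0 _ hk
        · exact hz _ (Finset.mem_range.2 (by omega))
      rw [this] at h1
      simp at h1
      exact h1.symm
    rw [this, sub_self]
    exact zero_mem _

theorem KH_mo (n : ℕ) : KH (mo K col sg false) n := by
  classical
  rintro k hk y ⟨x, -, hx⟩
  apply span_dl
  have h1 := dl_span (mo K col sg false) k x
  rw [hx] at h1
  have e : (mo K col sg false '' {i | i < k}) =
      (fun s => monomial s (1 : K)) '' ((Ex col sg false) '' {i | i < k}) := by
    rw [Set.image_image]; rfl
  rw [e, mem_ideal_span_monomial_image] at h1 ⊢
  intro t ht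
  have ht' : Ex col sg false k + t ∈ (mo K col sg false k * y).support := by
    rw [mem_support_iff] at ht ⊢
    rw [mo, coeff_monomial_mul]
    simpa using ht
  obtain ⟨_, ⟨i, hi, rfl⟩, hle⟩ := h1 _ ht'
  refine ⟨_, ⟨i, hi, rfl⟩, ?_⟩
  intro c
  have := hle c
  simp only [Finsupp.add_apply, Ex_apply] at this ⊢
  have hi' : i < k := hi
  split_ifs at this ⊢ with h2 h3 <;> omega

theorem MH_mo (n : ℕ) (α β : ℕ → σ) (hα : ∀ i, i + 1 < n → ∀ e, (col e = i ∧ sg e = true) ↔ e = α i)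
    (hβ : ∀ i, i + 1 < n → ∀ e, (col e = i ∧ sg e = false) ↔ e = β i) :
    MH (mo K col sg true) (mo K col sg false) n := by
  classical
  rintro k hk y ⟨x, -, hx1, hx2⟩
  rw [InI_iff]
  rcases Nat.eq_zero_or_pos k with rfl | hk0
  · have : dl (mo K col sg true) 0 x (emp 0) = 0 := rfl
    rw [this] at hx1
    have hne : mo K col sg true 0 ≠ 0 := by simp [mo]
    rcases mul_eq_zero.1 hx1.symm with h | h
    · exact absurd h hne
    · rw [h]; exact zero_mem _
  have hA : ∀ i < k, mo K col sg true i = X (α i) := by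
    intro i hi
    rw [mo, X]
    refine congrArg (fun t => monomial t (1 : K)) (Finsupp.ext fun e => ?_)
    rw [Ex_apply, Finsupp.single_apply]
    simp only [hα i (by omega) e, @eq_comm _ (α i) e]
  have hB : ∀ i < k, mo K col sg false i = X (β i) := by
    intro i hi
    rw [mo, X]
    refine congrArg (fun t => monomial t (1 : K)) (Finsupp.ext fun e => ?_)
    rw [Ex_apply, Finsupp.single_apply]
    simp only [hβ i (by omega) e, @eq_comm _ (β i) e]
  have cα : ∀ i < k, col (α i) = i ∧ sg (α i) = true := fun i hi => (hα i (by omega) _).2 rfl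
  have cβ : ∀ i < k, col (β i) = i ∧ sg (β i) = false := fun i hi => (hβ i (by omega) _).2 rfl
  let w : σ → Option σ →₀ ℕ := fun e => if col e < k ∧ sg e = false then
    Finsupp.single (some (α (col e))) 1 + Finsupp.single none 1 else Finsupp.single (some e) 1
  let φ : MvPolynomial σ K →ₐ[K] MvPolynomial (Option σ) K := aeval (fun e => monomial (w e) 1)
  have hφ : ∀ e, φ (X e) = monomial (w e) 1 := fun e => aeval_X _ _
  have wα : ∀ i < k, w (α i) = Finsupp.single (some (α i)) 1 := by
    intro i hi
    simp [w, cα i hi]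
  have wβ : ∀ i < k, w (β i) = Finsupp.single (some (α i)) 1 + Finsupp.single none 1 := by
    intro i hi
    simp [w, cβ i hi, hi]
  have hJ : ∀ z ∈ J (mo K col sg true) (mo K col sg false) k, φ z = 0 := by
    intro z hz
    have : J (mo K col sg true) (mo K col sg false) k ≤ RingHom.ker φ := by
      apply Ideal.span_le.2
      rintro _ ⟨i, hi, j, hj, rfl⟩
      rw [SetLike.mem_coe, RingHom.mem_ker, map_sub, map_mul, map_mul, hA i hi, hA j hj, hB i hi,
        hB j hj, hφ, hφ, hφ, hφ, wα i hi, wα j hj, wβ i hi, wβ j hj, monomial_mul, monomial_mul,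
        sub_eq_zero]
      refine congrArg (fun t => monomial t (1 * 1 : K)) ?_
      ac_rfl
    exact this hz
  have hz : (mo K col sg true 0 * mo K col sg false k - mo K col sg false 0 * mo K col sg true k) * y
      ∈ J (mo K col sg true) (mo K col sg false) k := by
    have := cross_mem (mo K col sg true) (mo K col sg false) le_rfl hk0 x
    rw [hx1, hx2] at this
    convert this using 1
    ring
  have hz2 := hJ _ hz
  rw [map_mul] at hz2
  have hne : φ (mo K col sg true 0 * mo K col sg false k
      - mo K col sg false 0 * mo K col sg true k) ≠ 0 := by
    intro h
    let ψ : MvPolynomial (Option σ) K →ₐ[K] K := aeval (fun o => if o = none then 0 else 1)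
    have h1 : ψ (φ (mo K col sg false k)) = 1 := by
      rw [mo, monomial_eq, map_mul, Finsupp.prod, map_prod, C_1, map_one, one_mul, map_prod]
      apply Finset.prod_eq_one
      intro e he
      rw [Finsupp.mem_support_iff, Ex_apply] at he
      have he' : col e = k := by by_contra h'; simp [h'] at he
      have : w e = Finsupp.single (some e) 1 := by simp [w, he']
      rw [map_pow, map_pow, hφ, this]
      have : ψ (X (some e)) = 1 := by rw [aeval_X]; simp
      rw [X] at this
      rw [this, one_pow]
    have h2 : ψ (φ (mo K col sg true 0)) = 1 := by
      rw [hA 0 hk0, hφ, wα 0 hk0]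
      have : ψ (X (some (α 0))) = 1 := by rw [aeval_X]; simp
      exact this
    have h3 : ψ (φ (mo K col sg false 0)) = 0 := by
      rw [hB 0 hk0, hφ, wβ 0 hk0]
      have : ψ (X (some (α 0)) * X none) = 0 := by rw [map_mul, aeval_X, aeval_X]; simp
      rw [X, X, monomial_mul, one_mul] at this
      exact this
    have := congrArg ψ h
    rw [map_sub, map_sub, map_mul, map_mul, map_mul, map_mul, h1, h2, h3] at this
    simp at this
  have hy := (mul_eq_zero.1 hz2).resolve_left hne
  refine ker_le w φ hφ _ ?_ y hy
  intro m m' hmm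
  have hw : ∀ m : σ →₀ ℕ, ∀ o, (m.sum fun e c => c • w e) o = ∑ e, m e * w e o := by
    intro m o
    rw [Finsupp.sum_fintype _ _ (by simp), Finsupp.finsetSum_apply]
    simp
  have hco : ∀ o, ∑ e, m e * w e o = ∑ e, m' e * w e o := by
    intro o
    rw [← hw, ← hw, hmm]
  have hsome : ∀ e, col e < k ∨ m e = m' e := by
    intro e
    by_cases he : col e < k
    · exact Or.inl he
    · right
      have hh : ∀ m : σ →₀ ℕ, ∑ e', m e' * w e' (some e) = m e := by
        intro m
        rw [Finset.sum_eq_single e]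
        · simp [w, he]
        · intro e' _ hne
          by_cases hc : col e' < k ∧ sg e' = false
          · have : α (col e') ≠ e := by
              rintro rfl; rw [(cα _ hc.1).1] at he; exact he hc.1
            simp [w, hc, this]
          · simp [w, hc, hne]
        · simp
      have := hco (some e)
      rwa [hh, hh] at this
  have hab : ∀ i < k, m (α i) + m (β i) = m' (α i) + m' (β i) := by
    intro i hi
    have hne : α i ≠ β i := by
      intro h
      have h1 := (cα i hi).2
      rw [h, (cβ i hi).2] at h1
      simp at h1
    have hh : ∀ m : σ →₀ ℕ, ∑ e', m e' * w e' (some (α i)) = m (α i) + m (β i) := by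
      intro m
      rw [← Finset.sum_subset (Finset.subset_univ {α i, β i}), Finset.sum_pair hne, wα i hi, wβ i hi]
      · simp
      · intro e _ he
        simp only [Finset.mem_insert, Finset.mem_singleton, not_or] at he
        by_cases hc : col e < k ∧ sg e = false
        · have : α (col e) ≠ α i := by
            intro h
            have h1 := (cα _ hc.1).1
            rw [h, (cα i hi).1] at h1
            exact he.2 ((hβ i (by omega) e).1 ⟨h1.symm, hc.2⟩)
          simp [w, hc, this]
        · simp [w, hc, he.1]
    have := hco (some (α i))
    rwa [hh, hh] at this
  have hnone : ∑ i ∈ Finset.range k, m (β i) = ∑ i ∈ Finset.range k, m' (β i) := by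
    have hh : ∀ m : σ →₀ ℕ, ∑ e', m e' * w e' none = ∑ i ∈ Finset.range k, m (β i) := by
      intro m
      have inj : Set.InjOn β (Finset.range k : Set ℕ) := by
        intro i hi j hj h
        simp only [Finset.coe_range, Set.mem_Iio] at hi hj
        rw [← (cβ i hi).1, h, (cβ j hj).1]
      rw [← Finset.sum_image (f := fun e => m e) inj,
        ← Finset.sum_subset (Finset.subset_univ ((Finset.range k).image β))]
      · apply Finset.sum_congr rfl
        intro e he
        obtain ⟨i, hi, rfl⟩ := Finset.mem_image.1 he
        rw [wβ i (Finset.mem_range.1 hi)]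
        simp
      · intro e _ he
        by_cases hc : col e < k ∧ sg e = false
        · exact absurd (Finset.mem_image.2 ⟨col e, Finset.mem_range.2 hc.1,
            ((hβ (col e) (by omega) e).1 ⟨rfl, hc.2⟩).symm⟩) he
        · simp [w, hc]
    have := hco none
    rwa [hh, hh] at this
  refine comb col sg k _ m m' (fun i => if i < k then (m (β i) : ℤ) - m' (β i) else 0) ?_ ?_ rfl ?_
  · intro i hi; rw [if_neg (by omega)]
  · rw [Finset.sum_congr rfl (g := fun i => (m (β i) : ℤ) - m' (β i))
      (fun i hi => by rw [if_pos (Finset.mem_range.1 hi)]), Finset.sum_sub_distrib]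
    have : (∑ i ∈ Finset.range k, (m (β i) : ℤ)) = ∑ i ∈ Finset.range k, (m' (β i) : ℤ) := by
      exact_mod_cast hnone
    rw [this, sub_self]
  · intro e
    by_cases he : col e < k
    · rw [if_pos he]
      have h1 := hab _ he
      cases hse : sg e
      · have := (hβ (col e) (by omega) e).1 ⟨rfl, hse⟩
        simp only [← this]; simp
      · have := (hα (col e) (by omega) e).1 ⟨rfl, hse⟩
        simp only [← this] at h1 ⊢; simp; omega
    · rw [if_neg he]
      rcases hsome e with h | h
      · exact absurd h he
      · simp [h]
end
end EN


namespace EN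

lemma wt_congr {l l' : ℕ → ℕ} {n : ℕ} (h : ∀ k < n, l k = l' k) (s : B n) : wt l n s = wt l' n s := by
  induction n with
  | zero => rfl
  | succ n ih =>
    refine B_ind (P := fun s => wt l (n+1) s = wt l' (n+1) s) ?_ ?_ s
    · intro s; exact ih (fun k hk => h k (by omega)) s
    · intro s; rw [wt_inr, wt_inr, ih (fun k hk => h k (by omega)) s, h n (by omega)]

lemma crd_le (n : ℕ) (s : B n) : crd n s ≤ n := by
  induction n with
  | zero => exact le_rfl
  | succ n ih =>
    refine B_ind (P := fun s => crd (n+1) s ≤ n+1) ?_ ?_ s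
    · intro s; have : wt (fun _ => 1) n s ≤ n := ih s; rw [crd, wt_inl]; omega
    · intro s; have : wt (fun _ => 1) n s ≤ n := ih s; rw [crd, wt_inr]; omega

lemma exists_crd (n c : ℕ) (hc : c ≤ n) : ∃ s, crd n s = c := by
  induction n generalizing c with
  | zero => exact ⟨emp 0, by simp; omega⟩
  | succ n ih =>
    cases c with
    | zero => exact ⟨emp _, by simp⟩
    | succ c =>
      obtain ⟨s, hs⟩ := ih c (by omega)
      have hs : wt (fun _ => 1) n s = c := hs
      exact ⟨inr s, by rw [crd, wt_inr]; omega⟩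

section graph
variable (p r : ℕ)

def ll (i : ℕ) : ℕ := if i = p + 1 then r - 2 + 1 else 1

lemma ll_pos (i : ℕ) : 0 < ll p r i := by unfold ll; split_ifs <;> omega

abbrev E : Type := Σ i : Fin (p+2), Fin (2 * ll p r i)
abbrev V : Type := Bool ⊕ E p r

def pos (i : Fin (p+2)) (j : ℕ) : V p r :=
  if h : 0 < j ∧ j < 2 * ll p r i then Sum.inr ⟨i, ⟨j, h.2⟩⟩ else Sum.inl (decide (j ≠ 0))

lemma pos_inr (i i' : Fin (p+2)) (j : ℕ) (j' : Fin (2 * ll p r i')) :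
    pos p r i j = Sum.inr ⟨i', j'⟩ ↔ i = i' ∧ j = j' ∧ 0 < j := by
  unfold pos
  split_ifs with h
  · constructor
    · intro e
      have e := Sum.inr.inj e
      obtain ⟨rfl, e⟩ := Sigma.mk.inj_iff.1 e
      rw [heq_eq_eq] at e
      subst e
      exact ⟨rfl, rfl, h.1⟩
    · rintro ⟨rfl, rfl, -⟩; rfl
  · constructor
    · intro e; simp at e
    · rintro ⟨rfl, rfl, h'⟩; exact absurd ⟨h', j'.2⟩ h

lemma pos_inl (i : Fin (p+2)) (j : ℕ) : pos p r i j = Sum.inl false ↔ j = 0 := by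
  have := ll_pos p r i
  unfold pos
  split_ifs with h
  · simp; omega
  · simp

lemma pos_inl_true (i : Fin (p+2)) (j : ℕ) : pos p r i j = Sum.inl true ↔ 2 * ll p r i ≤ j := by
  have := ll_pos p r i
  unfold pos
  split_ifs with h
  · simp; omega
  · simp; omega

lemma pos_eq (i i' : Fin (p+2)) (j j' : ℕ) (h : pos p r i j = pos p r i' j') (hj : j ≤ 2 * ll p r i)
    (hj' : j' ≤ 2 * ll p r i') :
    (i = i' ∧ j = j') ∨ (j = 0 ∧ j' = 0) ∨ (j = 2 * ll p r i ∧ j' = 2 * ll p r i') := by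
  by_cases h1 : j' = 0
  · rw [(pos_inl p r i' j').2 h1, pos_inl] at h; omega
  by_cases h2 : 2 * ll p r i' ≤ j'
  · rw [(pos_inl_true p r i' j').2 h2, pos_inl_true] at h; omega
  have : pos p r i' j' = Sum.inr ⟨i', ⟨j', by omega⟩⟩ := (pos_inr ..).2 ⟨rfl, rfl, by omega⟩
  rw [this, pos_inr] at h
  exact Or.inl ⟨h.1, h.2.1⟩

def edg (x : E p r) : Sym2 (V p r) := s(pos p r x.1 x.2, pos p r x.1 (x.2 + 1))

def cl : V p r → Fin 2
  | Sum.inl _ => 0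
  | Sum.inr x => if x.2.1 % 2 = 0 then 0 else 1

lemma cl_pos (i : Fin (p+2)) (j : ℕ) (hj : j ≤ 2 * ll p r i) :
    cl p r (pos p r i j) = if j % 2 = 0 then 0 else 1 := by
  unfold pos
  split_ifs with h h' h' <;> simp only [cl]
  · simp [h']
  · simp [h']
  · omega

lemma edg_inj : Function.Injective (edg p r) := by
  rintro ⟨i, j⟩ ⟨i', j'⟩ h
  have hl := ll_pos p r i
  have hl' := ll_pos p r i'
  have h1 := j.2
  have h2 := j'.2
  simp only [edg, Sym2.eq_iff] at h
  have key : i = i' ∧ (j : ℕ) = j' := by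
    rcases h with ⟨ha, hb⟩ | ⟨ha, hb⟩
    · have ha := pos_eq _ _ _ _ _ _ ha (by omega) (by omega)
      have hb := pos_eq _ _ _ _ _ _ hb (by omega) (by omega)
      omega
    · have ha := pos_eq _ _ _ _ _ _ ha (by omega) (by omega)
      have hb := pos_eq _ _ _ _ _ _ hb (by omega) (by omega)
      omega
  obtain ⟨rfl, h⟩ := key
  have := Fin.ext h
  subst this
  rfl

def GG : SimpleGraph (V p r) := SimpleGraph.fromEdgeSet (Set.range (edg p r))

lemma edg_ne (x : E p r) : pos p r x.1 x.2 ≠ pos p r x.1 (x.2 + 1) := by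
  intro h
  have := congrArg (cl p r) h
  rw [cl_pos _ _ _ _ (by omega), cl_pos _ _ _ _ (by omega)] at this
  split_ifs at this <;> first | omega | simp at this

lemma GG_edgeSet : (GG p r).edgeSet = Set.range (edg p r) := by
  rw [GG, SimpleGraph.edgeSet_fromEdgeSet]
  ext x
  constructor
  · exact fun h => h.1
  · rintro ⟨y, rfl⟩
    refine ⟨⟨y, rfl⟩, ?_⟩
    simpa [edg] using edg_ne p r y

lemma GG_col : (GG p r).Colorable 2 := by
  refine ⟨SimpleGraph.Coloring.mk (cl p r) ?_⟩
  intro v w h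
  rw [GG, SimpleGraph.fromEdgeSet_adj] at h
  obtain ⟨⟨x, hx⟩, -⟩ := h
  have key : cl p r (pos p r x.1 x.2) ≠ cl p r (pos p r x.1 (x.2 + 1)) := by
    rw [cl_pos _ _ _ _ (by omega), cl_pos _ _ _ _ (by omega)]
    split_ifs <;> first | omega | simp
  simp only [edg, Sym2.eq_iff] at hx
  rcases hx with ⟨h1, h2⟩ | ⟨h1, h2⟩
  · rw [← h1, ← h2]; exact key
  · rw [← h1, ← h2]; exact key.symm

noncomputable def eqv : E p r ≃ (GG p r).edgeSet :=
  (Equiv.ofInjective _ (edg_inj p r)).trans (Equiv.setCongr (GG_edgeSet p r).symm)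

lemma eqv_val (x : E p r) : ((eqv p r x : (GG p r).edgeSet) : Sym2 (V p r)) = edg p r x := rfl

noncomputable instance : Fintype (GG p r).edgeSet := Fintype.ofEquiv _ (eqv p r)

noncomputable def col (x : (GG p r).edgeSet) : ℕ := ((eqv p r).symm x).1
noncomputable def sg (x : (GG p r).edgeSet) : Bool := decide (((eqv p r).symm x).2.1 % 2 = 0)

lemma col_eqv (i : Fin (p+2)) (j : Fin (2 * ll p r i)) : col p r (eqv p r ⟨i, j⟩) = i := by
  rw [col, Equiv.symm_apply_apply]

lemma sg_eqv (i : Fin (p+2)) (j : Fin (2 * ll p r i)) :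
    sg p r (eqv p r ⟨i, j⟩) = decide (j.1 % 2 = 0) := by
  rw [sg, Equiv.symm_apply_apply]

lemma sum_edges {M : Type*} [AddCommMonoid M] (f : (GG p r).edgeSet → M) :
    ∑ x, f x = ∑ i : Fin (p+2), ∑ j : Fin (2 * ll p r i), f (eqv p r ⟨i, j⟩) := by
  rw [← Equiv.sum_comp (eqv p r), Fintype.sum_sigma]

lemma prod_edges {M : Type*} [CommMonoid M] (f : (GG p r).edgeSet → M) :
    ∏ x, f x = ∏ i : Fin (p+2), ∏ j : Fin (2 * ll p r i), f (eqv p r ⟨i, j⟩) := by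
  rw [← Equiv.prod_comp (eqv p r), Fintype.prod_sigma]

lemma prod_true {M : Type*} [CommMonoid M] (g : ℕ → M) (l : ℕ) :
    ∏ j ∈ Finset.range (2 * l), (g j * g (j+1)) ^ (if j % 2 = 0 then 1 else 0) =
      ∏ j ∈ Finset.range (2 * l), g j := by
  induction l with
  | zero => simp
  | succ l ih =>
    rw [show 2 * (l+1) = 2 * l + 1 + 1 by ring, Finset.prod_range_succ, Finset.prod_range_succ, ih,
      Finset.prod_range_succ, Finset.prod_range_succ, if_pos (by omega), if_neg (by omega)]
    simp [mul_assoc]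

lemma prod_false {M : Type*} [CommMonoid M] (g : ℕ → M) (l : ℕ) :
    ∏ j ∈ Finset.range (2 * l), (g j * g (j+1)) ^ (if j % 2 = 0 then 0 else 1) =
      ∏ j ∈ Finset.range (2 * l), g (j + 1) := by
  induction l with
  | zero => simp
  | succ l ih =>
    rw [show 2 * (l+1) = 2 * l + 1 + 1 by ring, Finset.prod_range_succ, Finset.prod_range_succ, ih,
      Finset.prod_range_succ, Finset.prod_range_succ, if_pos (by omega), if_neg (by omega)]
    simp [mul_assoc]

lemma Ex_eqv (β : Bool) (i i' : Fin (p+2)) (j : Fin (2 * ll p r i')) :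
    Ex (col p r) (sg p r) β i (eqv p r ⟨i', j⟩) =
      if i' = i then (if j.1 % 2 = 0 then (if β = true then 1 else 0) else (if β = true then 0 else 1))
        else 0 := by
  rw [Ex_apply]
  simp only [col_eqv, sg_eqv]
  by_cases h : i' = i
  · subst h
    cases β <;> simp
    split_ifs <;> first | rfl | omega
  · have : (i' : ℕ) ≠ i := fun h' => h (Fin.ext h')
    simp [h, this]

variable (K : Type) [Field K]

/-- the toric map -/
noncomputable def tor : MvPolynomial (GG p r).edgeSet K →ₐ[K] MvPolynomial (V p r) K :=
  (MvPolynomial.aeval (R := K) (fun e : (GG p r).edgeSet =>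
    Sym2.lift ⟨fun a b => (X a * X b : MvPolynomial (V p r) K),
      fun a b => mul_comm _ _⟩ (e : Sym2 (V p r))))

lemma mem_toric (y : MvPolynomial (GG p r).edgeSet K) :
    y ∈ toricIdeal K (GG p r) ↔ tor p r K y = 0 := Iff.rfl

lemma tor_X (x : E p r) :
    tor p r K (X (eqv p r x)) = X (pos p r x.1 x.2) * X (pos p r x.1 (x.2 + 1)) := by
  rw [tor, aeval_X, eqv_val]; rfl

lemma tor_mo (β : Bool) (i : Fin (p+2)) :
    tor p r K (mo K (col p r) (sg p r) β i) = ∏ j ∈ Finset.range (2 * ll p r i),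
      (X (pos p r i j) * X (pos p r i (j+1))) ^
        (if j % 2 = 0 then (if β = true then 1 else 0) else (if β = true then 0 else 1)) := by
  rw [mo, monomial_eq, map_mul, C_1, map_one, one_mul, Finsupp.prod_fintype _ _ (by simp), map_prod,
    prod_edges, Finset.prod_eq_single i]
  · rw [← Fin.prod_univ_eq_prod_range (fun j => ((X (pos p r i j) * X (pos p r i (j+1))) ^
        (if j % 2 = 0 then (if β = true then 1 else 0) else (if β = true then 0 else 1)) :
        MvPolynomial (V p r) K))]
    refine Finset.prod_congr rfl fun j _ => ?_
    rw [map_pow, tor_X, Ex_eqv, if_pos rfl]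
  · intro i' _ h
    apply Finset.prod_eq_one
    intro j _
    rw [Ex_eqv, if_neg h, pow_zero, map_one]
  · simp

lemma tor_rel (i : Fin (p+2)) :
    tor p r K (mo K (col p r) (sg p r) true i) * X (Sum.inl true) =
      X (Sum.inl false) * tor p r K (mo K (col p r) (sg p r) false i) := by
  have h1 := prod_true (fun j => (X (pos p r i j) : MvPolynomial (V p r) K)) (ll p r i)
  have h2 := prod_false (fun j => (X (pos p r i j) : MvPolynomial (V p r) K)) (ll p r i)
  rw [tor_mo, tor_mo]
  simp only [if_true, Bool.false_eq_true, if_false]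
  rw [h1, h2]
  have h3 := Finset.prod_range_succ (fun j => (X (pos p r i j) : MvPolynomial (V p r) K))
    (2 * ll p r i)
  rw [Finset.prod_range_succ'] at h3
  rw [(pos_inl p r i 0).2 rfl, (pos_inl_true p r i _).2 le_rfl] at h3
  rw [← h3, mul_comm]

lemma J_le (y : MvPolynomial (GG p r).edgeSet K)
    (hy : y ∈ J (mo K (col p r) (sg p r) true) (mo K (col p r) (sg p r) false) (p+2)) :
    tor p r K y = 0 := by
  have : J (mo K (col p r) (sg p r) true) (mo K (col p r) (sg p r) false) (p+2)
      ≤ RingHom.ker (tor p r K) := by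
    apply Ideal.span_le.2
    rintro _ ⟨i, hi, j, hj, rfl⟩
    rw [SetLike.mem_coe, RingHom.mem_ker, map_sub, map_mul, map_mul]
    have h1 := tor_rel p r K ⟨i, hi⟩
    have h2 := tor_rel p r K ⟨j, hj⟩
    simp only at h1 h2
    have hX : (X (Sum.inl false) : MvPolynomial (V p r) K) ≠ 0 := X_ne_zero _
    apply mul_left_cancel₀ hX
    linear_combination tor p r K (mo K (col p r) (sg p r) true j) * h1
      - tor p r K (mo K (col p r) (sg p r) true i) * h2
  exact this hy

noncomputable def ww (x : (GG p r).edgeSet) : V p r →₀ ℕ :=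
  Finsupp.single (pos p r ((eqv p r).symm x).1 ((eqv p r).symm x).2) 1 +
  Finsupp.single (pos p r ((eqv p r).symm x).1 (((eqv p r).symm x).2 + 1)) 1

lemma le_J (y : MvPolynomial (GG p r).edgeSet K) (hy : tor p r K y = 0) :
    y ∈ J (mo K (col p r) (sg p r) true) (mo K (col p r) (sg p r) false) (p+2) := by
  classical
  refine ker_le (ww p r) (tor p r K) ?_ _ ?_ y hy
  · intro e
    obtain ⟨x, rfl⟩ := (eqv p r).surjective e
    rw [tor_X, ww, Equiv.symm_apply_apply, X, X, monomial_mul, one_mul]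
  intro m m' hmm
  let M : ((GG p r).edgeSet →₀ ℕ) → Fin (p+2) → ℕ → ℕ := fun m i j =>
    if h : j < 2 * ll p r i then m (eqv p r ⟨i, ⟨j, h⟩⟩) else 0
  have hM : ∀ (m : (GG p r).edgeSet →₀ ℕ) (i : Fin (p+2)) (j : Fin (2 * ll p r i)), m (eqv p r ⟨i, j⟩) = M m i j := by
    intro m i j
    simp only [M]
    rw [dif_pos j.2]
  have hw : ∀ m : (GG p r).edgeSet →₀ ℕ, ∀ v, (m.sum fun e c => c • ww p r e) v =
      ∑ i : Fin (p+2), ∑ j ∈ Finset.range (2 * ll p r i), M m i j *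
        ((if pos p r i j = v then 1 else 0) + (if pos p r i (j+1) = v then 1 else 0)) := by
    intro m v
    rw [Finsupp.sum_fintype _ _ (by simp), Finsupp.finsetSum_apply, sum_edges]
    refine Finset.sum_congr rfl fun i _ => ?_
    rw [← Fin.sum_univ_eq_sum_range (fun j => M m i j *
        ((if pos p r i j = v then 1 else 0) + (if pos p r i (j+1) = v then 1 else 0)))]
    refine Finset.sum_congr rfl fun j _ => ?_
    rw [Finsupp.smul_apply, ww, Equiv.symm_apply_apply, hM, Finsupp.add_apply, smul_eq_mul,
      Finsupp.single_apply, Finsupp.single_apply]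
  have hfalse : ∀ m : (GG p r).edgeSet →₀ ℕ, (m.sum fun e c => c • ww p r e) (Sum.inl false) =
      ∑ i : Fin (p+2), M m i 0 := by
    intro m
    rw [hw]
    refine Finset.sum_congr rfl fun i _ => ?_
    have := ll_pos p r i
    rw [Finset.sum_eq_single 0]
    · simp [pos_inl]
    · intro j _ hj; simp [pos_inl, hj]
    · intro h; simp at h; omega
  have hint : ∀ m : (GG p r).edgeSet →₀ ℕ, ∀ (i : Fin (p+2)) (j : ℕ) (h : j + 1 < 2 * ll p r i),
      (m.sum fun e c => c • ww p r e) (Sum.inr ⟨i, ⟨j+1, h⟩⟩) = M m i (j+1) + M m i j := by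
    intro m i j h
    rw [hw, Finset.sum_eq_single i]
    · simp only [pos_inr, mul_add, Finset.sum_add_distrib]
      congr 1
      · rw [Finset.sum_eq_single (j+1)]
        · simp
        · intro t _ ht; simp [ht]
        · intro h'; simp at h'; omega
      · rw [Finset.sum_eq_single j]
        · simp
        · intro t _ ht; simp [ht]
        · intro h'; simp at h'; omega
    · intro i' _ hi'
      apply Finset.sum_eq_zero
      intro t _
      simp [pos_inr, hi']
    · simp
  have h0 : ∑ i : Fin (p+2), M m i 0 = ∑ i : Fin (p+2), M m' i 0 := by
    rw [← hfalse, ← hfalse, hmm]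
  have h1 : ∀ (i : Fin (p+2)) (j : ℕ), j + 1 < 2 * ll p r i →
      M m i (j+1) + M m i j = M m' i (j+1) + M m' i j := by
    intro i j h
    rw [← hint m i j h, ← hint m' i j h, hmm]
  have h2 : ∀ (i : Fin (p+2)) (j : ℕ), j < 2 * ll p r i →
      (M m' i j : ℤ) = M m i j + ((M m' i 0 : ℤ) - M m i 0) * (if j % 2 = 0 then 1 else -1) := by
    intro i j
    induction j with
    | zero => intro _; simp
    | succ j ih =>
      intro hj
      have a1 := ih (by omega)
      have a2 := h1 i j hj
      by_cases hp : j % 2 = 0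
      · rw [if_pos hp] at a1
        rw [if_neg (by omega)]
        omega
      · rw [if_neg hp] at a1
        rw [if_pos (by omega)]
        omega
  refine comb (col p r) (sg p r) (p+2) _ m m'
    (fun i => if h : i < p+2 then (M m' ⟨i, h⟩ 0 : ℤ) - M m ⟨i, h⟩ 0 else 0) ?_ ?_ rfl ?_
  · intro i hi; rw [dif_neg (by omega)]
  · rw [← Fin.sum_univ_eq_sum_range
      (fun i => if h : i < p+2 then (M m' ⟨i, h⟩ 0 : ℤ) - M m ⟨i, h⟩ 0 else 0)]
    simp only [Fin.is_lt, dif_pos, Fin.eta]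
    rw [Finset.sum_sub_distrib]
    have : (∑ i : Fin (p+2), (M m i 0 : ℤ)) = ∑ i : Fin (p+2), (M m' i 0 : ℤ) := by
      exact_mod_cast h0
    rw [this, sub_self]
  · intro e
    obtain ⟨⟨i, j⟩, rfl⟩ := (eqv p r).surjective e
    have := h2 i j j.2
    rw [hM, hM, this]
    simp only [col_eqv, sg_eqv, Fin.is_lt, dif_pos, Fin.eta, decide_eq_true_eq]

lemma mo_hom (β : Bool) (i : Fin (p+2)) :
    mo K (col p r) (sg p r) β i ∈ homogeneousSubmodule (GG p r).edgeSet K (ll p r i) := by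
  apply isHomogeneous_monomial
  rw [Finsupp.degree_eq_sum, sum_edges, Finset.sum_eq_single i]
  · simp only [Ex_eqv, if_true]
    rw [Fin.sum_univ_eq_sum_range (fun j => (if j % 2 = 0 then (if β = true then 1 else 0)
      else (if β = true then 0 else 1)))]
    generalize ll p r i = l
    induction l with
    | zero => simp
    | succ l ih =>
      rw [show 2 * (l+1) = 2 * l + 1 + 1 by ring, Finset.sum_range_succ, Finset.sum_range_succ, ih]
      have e1 : 2 * l % 2 = 0 := by omega
      have e2 : (2 * l + 1) % 2 = 1 := by omega
      cases β <;> simp [e1, e2]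
  · intro i' _ h
    apply Finset.sum_eq_zero
    intro j _
    rw [Ex_eqv, if_neg h]
  · simp

theorem final (hr : 2 ≤ r) : ∃ res : MinFreeResOfIdeal (toricIdeal K (GG p r)),
        res.toMinFreeResData.pdim = (p : ℕ∞) ∧ res.toMinFreeResData.reg = (r : ℕ∞) := by
  have hl1 : ∀ k < p + 1, ll p r k = 1 := by
    intro k hk
    rw [ll, if_neg (by omega)]
  have hll : ll p r (p+1) = r - 1 := by rw [ll, if_pos rfl]; omega
  refine resolution _ (mo K (col p r) (sg p r) true) (mo K (col p r) (sg p r) false) (ll p r) (p+2)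
    ?_ (KH_mo _ _ _) ?_ ?_ ?_ p r ?_ ?_ ?_
  · refine MH_mo _ _ _
      (fun i => eqv p r ⟨⟨i % (p+2), Nat.mod_lt _ (by omega)⟩, ⟨0, by have := ll_pos p r (i % (p+2)); show 0 < 2 * ll p r (i % (p+2)); omega⟩⟩)
      (fun i => eqv p r ⟨⟨i % (p+2), Nat.mod_lt _ (by omega)⟩, ⟨1, by have := ll_pos p r (i % (p+2)); show 1 < 2 * ll p r (i % (p+2)); omega⟩⟩)
      ?_ ?_
    · intro i hi e
      obtain ⟨⟨t, j⟩, rfl⟩ := (eqv p r).surjective e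
      have hmod : i % (p+2) = i := Nat.mod_eq_of_lt (by omega)
      constructor
      · rw [col_eqv, sg_eqv, decide_eq_true_eq, EmbeddingLike.apply_eq_iff_eq]
        rintro ⟨rfl, h⟩
        have h1 := hl1 t (by omega)
        have h2 := j.2
        rw [Sigma.ext_iff]
        have : (⟨(t : ℕ) % (p+2), Nat.mod_lt _ (by omega)⟩ : Fin (p+2)) = t := Fin.ext hmod
        refine ⟨this.symm, ?_⟩
        rw [Fin.heq_ext_iff (by simp only [hmod])]
        simp only; omega
      · intro h
        rw [h, col_eqv, sg_eqv]; exact ⟨hmod, rfl⟩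
    · intro i hi e
      obtain ⟨⟨t, j⟩, rfl⟩ := (eqv p r).surjective e
      have hmod : i % (p+2) = i := Nat.mod_eq_of_lt (by omega)
      constructor
      · rw [col_eqv, sg_eqv, decide_eq_false_iff_not, EmbeddingLike.apply_eq_iff_eq]
        rintro ⟨rfl, h⟩
        have h1 := hl1 t (by omega)
        have h2 := j.2
        rw [Sigma.ext_iff]
        have : (⟨(t : ℕ) % (p+2), Nat.mod_lt _ (by omega)⟩ : Fin (p+2)) = t := Fin.ext hmod
        refine ⟨this.symm, ?_⟩
        rw [Fin.heq_ext_iff (by simp only [hmod])]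
        simp only; omega
      · intro h
        rw [h, col_eqv, sg_eqv]; exact ⟨hmod, rfl⟩
  · intro y
    rw [InI_iff, mem_toric]
    exact ⟨le_J p r K y, J_le p r K y⟩
  · intro k hk; exact ⟨ll_pos p r k, mo_hom p r K true ⟨k, hk⟩⟩
  · intro k hk; exact ⟨ll_pos p r k, mo_hom p r K false ⟨k, hk⟩⟩
  · intro i
    constructor
    · rintro ⟨s, hs⟩
      have := crd_le (p+2) s; omega
    · intro h; exact exists_crd _ _ (by omega)
  · intro i
    refine B_ind ?_ ?_
    · intro s hs
      rw [wt_inl, wt_congr hl1]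
      rw [crd, wt_inl] at hs
      omega
    · intro s hs
      rw [wt_inr, wt_congr hl1, hll]
      rw [crd, wt_inr] at hs
      omega
  · obtain ⟨s, hs⟩ := exists_crd (p+1) 1 (by omega)
    refine ⟨0, inr s, ?_, ?_⟩
    · have hs : wt (fun _ => 1) (p+1) s = 1 := hs
      rw [crd, wt_inr]; omega
    · rw [wt_inr, wt_congr hl1, hll]
      have hs : wt (fun _ => 1) (p+1) s = 1 := hs
      omega

end graph
end EN


/-- For every `p ≥ 0` and `r ≥ 2` there exists a (finite) bipartite graph `G` with
`pdim(I_G) = p` and `reg(I_G) = r`. -/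
theorem stmt_18 (K : Type) [Field K] (p r : ℕ) (hr : 2 ≤ r) :
    ∃ (V : Type) (_ : Fintype V) (G : SimpleGraph V), G.Colorable 2 ∧
      ∃ res : MinFreeResOfIdeal (toricIdeal K G),
        res.toMinFreeResData.pdim = (p : ℕ∞) ∧
        res.toMinFreeResData.reg = (r : ℕ∞) := by
  exact ⟨EN.V p r, inferInstance, EN.GG p r, EN.GG_col p r, EN.final p r K hr⟩
end

section
/- Let ℓ,s,t ≥ 1 and h ≥ 2 be integers and let J be the monomial ideal of the previous context (initial ideal of I_{B_{ℓ,h}^{s,t}}), i.e., generated by {Y_{1,j}Y_{2,i} : i < j} ∪ {Y_{1,i}Y_{1,j}U : i < j} ∪ {Y_{1,i}²U : 1 ≤ i ≤ h} with Y's of degree ℓ and U of degree s+t+1, all with pairwise disjoint supports. Then the graded Betti numbers are β_{i,j}(J) = (i+1)·C(h, i+2) if j = ℓ(i+2); β_{i,j}(J) = C(2h, i+2) − (i+3)·C(h, i+2) if j = ℓ(i+2) + s + t + 1; and β_{i,j}(J) = 0 otherwise. -/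
open MvPolynomial

/-- `L` is generated by a regular sequence of `r` monomials whose degrees are given by `a`
(a sequence of monomials is regular iff the supports are pairwise disjoint and each is
nonconstant). -/
def IsRegSeqSpan {K : Type} [Field K] {σ : Type} (L : Ideal (MvPolynomial σ K))
    (r : ℕ) (a : Fin r → ℕ) : Prop :=
  ∃ α : Fin r → (σ →₀ ℕ),
    (∀ t, (α t).support.Nonempty) ∧
    (∀ s t, s ≠ t → Disjoint (α s).support (α t).support) ∧
    (∀ t, (monomial (α t) (1 : K)).totalDegree = a t) ∧
    L = Ideal.span (Set.range fun t => monomial (α t) (1 : K))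


section Aux

variable {K : Type} [Field K] {σ : Type}

noncomputable def cmpt (D g : ℕ) (p : MvPolynomial σ K) : MvPolynomial σ K :=
  if g ≤ D then homogeneousComponent (D - g) p else 0

theorem hc_mul (n r : ℕ) (w T : MvPolynomial σ K) (hT : T.IsHomogeneous r) :
    homogeneousComponent n (w * T) = cmpt n r w * T := by
  classical
  let _ := MvPolynomial.gradedAlgebra (σ := σ) (R := K)
  have h := DirectSum.coe_decompose_mul_of_right_mem (homogeneousSubmodule σ K) (a := w) (b := T)
    (i := r) n ((mem_homogeneousSubmodule _ _).2 hT)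
  have e : ∀ (q : MvPolynomial σ K) (m : ℕ),
      (((DirectSum.decompose (homogeneousSubmodule σ K)) q m : homogeneousSubmodule σ K m) : MvPolynomial σ K)
        = homogeneousComponent m q := fun q m => decomposition.decompose'_apply q m
  rw [e, e] at h
  rw [h, cmpt]
  split_ifs <;> simp

theorem cmpt_mul (D g' g : ℕ) (w T : MvPolynomial σ K)
    (hT : T ≠ 0 → ∃ r, r + g' = g ∧ T.IsHomogeneous r) :
    cmpt D g' (w * T) = cmpt D g w * T := by
  by_cases h0 : T = 0
  · subst h0; simp [cmpt]
  obtain ⟨r, hr, hT⟩ := hT h0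
  unfold cmpt
  split_ifs with h1 h2 h2
  · rw [hc_mul _ r _ _ hT, cmpt, if_pos (by omega)]
    congr 3; omega
  · rw [hc_mul _ r _ _ hT, cmpt, if_neg (by omega)]
  · omega
  · simp

theorem cmpt_self (D g : ℕ) (p : MvPolynomial σ K)
    (hp : p ≠ 0 → ∃ r, r + g = D ∧ p.IsHomogeneous r) : cmpt D g p = p := by
  by_cases h0 : p = 0
  · subst h0; simp [cmpt]
  obtain ⟨r, hr, hT⟩ := hp h0
  rw [cmpt, if_pos (by omega), show D - g = r by omega]
  exact homogeneousComponent_eq_self hT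

theorem cmpt_hom (D g : ℕ) (p : MvPolynomial σ K) (h : cmpt D g p ≠ 0) :
    ∃ r, r + g = D ∧ (cmpt D g p).IsHomogeneous r := by
  unfold cmpt at *
  split_ifs at * with h1
  · exact ⟨D - g, by omega, homogeneousComponent_isHomogeneous _ _⟩
  · exact absurd rfl h

theorem cmpt_sum {α : Type} (D g : ℕ) (s : Finset α) (f : α → MvPolynomial σ K) :
    cmpt D g (∑ i ∈ s, f i) = ∑ i ∈ s, cmpt D g (f i) := by
  unfold cmpt
  split_ifs
  · exact map_sum _ _ _
  · simp

/-- bihomogeneous vectors -/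
def HH {ι : Type} (a g : ι → ℕ) (p D : ℕ) (x : ι →₀ MvPolynomial σ K) : Prop :=
  ∀ l, x l ≠ 0 → a l = p ∧ ∃ r, r + g l = D ∧ (x l).IsHomogeneous r

theorem HH.zero {ι : Type} {a g : ι → ℕ} {p D : ℕ} :
    HH a g p D (0 : ι →₀ MvPolynomial σ K) := fun _ h => absurd rfl h

theorem HH.add {ι : Type} {a g : ι → ℕ} {p D : ℕ} {x y : ι →₀ MvPolynomial σ K}
    (hx : HH a g p D x) (hy : HH a g p D y) : HH a g p D (x + y) := by
  intro l hl
  by_cases h1 : x l = 0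
  · have h2 : (x + y) l = y l := by simp [h1]
    rw [h2] at hl ⊢
    exact hy l hl
  · by_cases h2 : y l = 0
    · have h2 : (x + y) l = x l := by simp [h2]
      rw [h2] at hl ⊢
      exact hx l hl
    · obtain ⟨e, r, hr, h3⟩ := hx l h1
      obtain ⟨_, r', hr', h4⟩ := hy l h2
      have : r' = r := by omega
      subst this
      exact ⟨e, r', hr, h3.add h4⟩

theorem HH.smul {ι : Type} {a g : ι → ℕ} {p D r : ℕ} {c : MvPolynomial σ K}
    {x : ι →₀ MvPolynomial σ K}
    (hc : c.IsHomogeneous r) (hx : HH a g p D x) : HH a g p (D + r) (c • x) := by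
  intro l hl
  have h1 : x l ≠ 0 := by
    intro h; apply hl; simp [h]
  obtain ⟨e, r', hr, h3⟩ := hx l h1
  exact ⟨e, r + r', by omega, hc.mul h3⟩

theorem HH.neg {ι : Type} {a g : ι → ℕ} {p D : ℕ} {x : ι →₀ MvPolynomial σ K}
    (hx : HH a g p D x) : HH a g p D (-x) := by
  intro l hl
  have h1 : x l ≠ 0 := by
    intro h; apply hl; simp [h]
  obtain ⟨e, r', hr, h3⟩ := hx l h1
  exact ⟨e, r', hr, h3.neg⟩

theorem HH.sub {ι : Type} {a g : ι → ℕ} {p D : ℕ} {x y : ι →₀ MvPolynomial σ K}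
    (hx : HH a g p D x) (hy : HH a g p D y) : HH a g p D (x - y) := by
  rw [sub_eq_add_neg]; exact hx.add hy.neg

theorem HH.sum {ι α : Type} {a g : ι → ℕ} {p D : ℕ} (s : Finset α)
    (f : α → ι →₀ MvPolynomial σ K)
    (hx : ∀ i ∈ s, HH a g p D (f i)) : HH a g p D (∑ i ∈ s, f i) := by
  classical
  induction s using Finset.induction_on with
  | empty => simpa using HH.zero
  | insert i s hi ih =>
    rw [Finset.sum_insert hi]
    exact (hx i (by simp)).add (ih fun j hj => hx j (by simp [hj]))

theorem lin_expand {ι κ : Type} (T : (ι →₀ MvPolynomial σ K) →ₗ[MvPolynomial σ K] (κ →₀ MvPolynomial σ K))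
    (x : ι →₀ MvPolynomial σ K) :
    T x = ∑ k ∈ x.support, x k • T (Finsupp.single k 1) := by
  conv_lhs => rw [← Finsupp.sum_single x, Finsupp.sum, map_sum]
  refine Finset.sum_congr rfl fun k _ => ?_
  rw [← map_smul, Finsupp.smul_single, smul_eq_mul, mul_one]

theorem HH.single {ι : Type} {a g : ι → ℕ} (k : ι) :
    HH a g (a k) (g k) (Finsupp.single k (1 : MvPolynomial σ K)) := by
  intro l hl
  by_cases h : k = l
  · subst h
    exact ⟨rfl, 0, by omega, by simpa using isHomogeneous_one _ _⟩
  · exact absurd (Finsupp.single_eq_of_ne' h) hl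

theorem HH.map {ι κ : Type} {a g : ι → ℕ} {a' g' : κ → ℕ} {p D p' e : ℕ}
    (T : (ι →₀ MvPolynomial σ K) →ₗ[MvPolynomial σ K] (κ →₀ MvPolynomial σ K))
    (hT : ∀ k, a k = p → HH a' g' p' (g k + e) (T (Finsupp.single k 1)))
    {x : ι →₀ MvPolynomial σ K} (hx : HH a g p D x) : HH a' g' p' (D + e) (T x) := by
  rw [lin_expand]
  refine HH.sum _ _ fun k hk => ?_
  obtain ⟨h1, r, h2, h3⟩ := hx k (Finsupp.mem_support_iff.1 hk)
  have := HH.smul h3 (hT k h1)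
  rwa [show g k + e + r = D + e by omega] at this

structure GRes (I : Ideal (MvPolynomial σ K)) where
  ι : Type
  a : ι → ℕ
  g : ι → ℕ
  o : ι
  d : (ι →₀ MvPolynomial σ K) →ₗ[MvPolynomial σ K] (ι →₀ MvPolynomial σ K)
  ha : ∀ k, a k = 0 ↔ k = o
  go : g o = 0
  dH : ∀ k p, a k = p + 1 → HH a g p (g k) (d (Finsupp.single k 1))
  d0 : d (Finsupp.single o 1) = 0
  dd : ∀ x, d (d x) = 0
  dI : ∀ x, (d x) o ∈ I
  ex : ∀ p D x, HH a g p D x → d x = 0 → (p = 0 → x o ∈ I) → ∃ y, HH a g (p + 1) D y ∧ d y = x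
  hI : ∀ q ∈ I, ∀ D, homogeneousComponent D q ∈ I
  mn : ∀ x l, constantCoeff ((d x) l) = 0

theorem GRes.dmap {I : Ideal (MvPolynomial σ K)} (F : GRes I) {p D : ℕ} {x : F.ι →₀ MvPolynomial σ K}
    (hx : HH F.a F.g (p + 1) D x) : HH F.a F.g p D (F.d x) :=
  HH.map (e := 0) F.d (fun k hk => F.dH k p hk) hx

theorem GRes.H0 {I : Ideal (MvPolynomial σ K)} (F : GRes I) {D : ℕ} {x : F.ι →₀ MvPolynomial σ K}
    (hx : HH F.a F.g 0 D x) : x = Finsupp.single F.o (x F.o) := by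
  classical
  ext1 l
  by_cases h : l = F.o
  · subst h; simp
  · rw [Finsupp.single_eq_of_ne h]
    by_contra h'
    exact h ((F.ha l).1 (hx l h').1)

theorem agree {ι κ : Type} {a g : ι → ℕ} {p D : ℕ}
    (T T' : (ι →₀ MvPolynomial σ K) →ₗ[MvPolynomial σ K] (κ →₀ MvPolynomial σ K))
    (h : ∀ k, a k = p → T (Finsupp.single k 1) = T' (Finsupp.single k 1))
    {x : ι →₀ MvPolynomial σ K} (hx : HH a g p D x) : T x = T' x := by
  rw [lin_expand T, lin_expand T']
  refine Finset.sum_congr rfl fun k hk => ?_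
  rw [h k (hx k (Finsupp.mem_support_iff.1 hk)).1]

/-- define a linear map by changing one layer -/
theorem exists_layer {ι κ : Type} (a : ι → ℕ) (n : ℕ)
    (T : (ι →₀ MvPolynomial σ K) →ₗ[MvPolynomial σ K] (κ →₀ MvPolynomial σ K))
    (P : ι → (κ →₀ MvPolynomial σ K) → Prop)
    (h : ∀ k, a k = n → ∃ y, P k y) :
    ∃ T' : (ι →₀ MvPolynomial σ K) →ₗ[MvPolynomial σ K] (κ →₀ MvPolynomial σ K),
      (∀ k, a k ≠ n → T' (Finsupp.single k 1) = T (Finsupp.single k 1)) ∧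
      (∀ k, a k = n → P k (T' (Finsupp.single k 1))) := by
  classical
  choose f hf using h
  refine ⟨Finsupp.linearCombination _ (fun k => if hk : a k = n then f k hk
    else T (Finsupp.single k 1)), fun k hk => ?_, fun k hk => ?_⟩
  · simp [Finsupp.linearCombination_single, hk]
  · simp only [Finsupp.linearCombination_single, hk, one_smul, dif_pos]
    exact hf k hk

theorem lift_exists {I Q : Ideal (MvPolynomial σ K)} (F : GRes I) (G : GRes Q)
    (f : MvPolynomial σ K) (e : ℕ) (hf : f.IsHomogeneous e) (hfQ : ∀ q ∈ Q, q * f ∈ I) (n : ℕ) :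
    ∃ φ : (G.ι →₀ MvPolynomial σ K) →ₗ[MvPolynomial σ K] (F.ι →₀ MvPolynomial σ K),
      φ (Finsupp.single G.o 1) = Finsupp.single F.o f ∧
      ∀ k, G.a k ≤ n → HH F.a F.g (G.a k) (G.g k + e) (φ (Finsupp.single k 1)) ∧
        F.d (φ (Finsupp.single k 1)) = φ (G.d (Finsupp.single k 1)) := by
  classical
  have hs : (Finsupp.single F.o f : F.ι →₀ MvPolynomial σ K) = f • Finsupp.single F.o 1 := by
    simp
  induction n with
  | zero =>
    refine ⟨Finsupp.linearCombination _ (fun k => Finsupp.single F.o f), ?_, ?_⟩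
    · simp
    · intro k hk
      have hk : G.a k = 0 := by omega
      have hko := (G.ha k).1 hk
      subst hko
      rw [Finsupp.linearCombination_single, one_smul, G.d0, map_zero, hs, map_smul, F.d0, smul_zero]
      refine ⟨?_, rfl⟩
      have := HH.smul hf (HH.single (a := F.a) (g := F.g) (K := K) (σ := σ) F.o)
      rw [hk, G.go]
      rwa [(F.ha F.o).2 rfl, F.go] at this

  | succ n ih =>
    obtain ⟨φ, h0, hφ⟩ := ih
    have comm : ∀ p D x, p ≤ n → HH G.a G.g p D x → F.d (φ x) = φ (G.d x) := by
      intro p D x hp hx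
      exact agree (F.d ∘ₗ φ) (φ ∘ₗ G.d) (fun k hk => (hφ k (by omega)).2) hx
    obtain ⟨φ', h1, h2⟩ := exists_layer G.a (n + 1) φ
      (fun k y => HH F.a F.g (n + 1) (G.g k + e) y ∧ F.d y = φ (G.d (Finsupp.single k 1))) (by
        intro k hk
        have hd := G.dH k n hk
        apply F.ex
        · exact HH.map φ (fun k hk => hk ▸ (hφ k (by omega)).1) hd
        · rw [comm n _ _ le_rfl hd, G.dd, map_zero]
        · intro hn
          subst hn
          have := G.H0 hd
          rw [this, ← mul_one ((G.d (Finsupp.single k 1)) G.o), ← smul_eq_mul, ← Finsupp.smul_single,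
            map_smul, h0]
          simpa using hfQ _ (G.dI _))
    refine ⟨φ', ?_, ?_⟩
    · rw [h1, h0]
      rw [(G.ha _).2 rfl]; omega
    · intro k hk
      have key : φ' (G.d (Finsupp.single k 1)) = φ (G.d (Finsupp.single k 1)) := by
        rcases Nat.eq_zero_or_pos (G.a k) with hz | hz
        · rw [(G.ha k).1 hz, G.d0]; simp
        · obtain ⟨p, hp⟩ := Nat.exists_eq_succ_of_ne_zero hz.ne'
          exact agree φ' φ (fun l hl => h1 l (by omega)) (G.dH k p hp)
      rw [key]
      by_cases hkn : G.a k = n + 1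
      · rw [hkn]; exact h2 k hkn
      · rw [h1 k hkn]
        exact hφ k (by omega)

theorem homotopy_exists {I : Ideal (MvPolynomial σ K)} (F : GRes I)
    (θ : (F.ι →₀ MvPolynomial σ K) →ₗ[MvPolynomial σ K] (F.ι →₀ MvPolynomial σ K)) (N : ℕ)
    (h0 : θ (Finsupp.single F.o 1) = 0)
    (hθ : ∀ k, F.a k ≤ N → HH F.a F.g (F.a k) (F.g k) (θ (Finsupp.single k 1)) ∧
        F.d (θ (Finsupp.single k 1)) = θ (F.d (Finsupp.single k 1))) (n : ℕ) (hn : n ≤ N) :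
    ∃ H : (F.ι →₀ MvPolynomial σ K) →ₗ[MvPolynomial σ K] (F.ι →₀ MvPolynomial σ K),
      ∀ k, F.a k ≤ n → HH F.a F.g (F.a k + 1) (F.g k) (H (Finsupp.single k 1)) ∧
        θ (Finsupp.single k 1) = F.d (H (Finsupp.single k 1)) + H (F.d (Finsupp.single k 1)) := by
  classical
  induction n with
  | zero =>
    refine ⟨0, ?_⟩
    intro k hk
    have hk : F.a k = 0 := by omega
    have hko := (F.ha k).1 hk
    subst hko
    simp [h0, HH.zero]
  | succ n ih =>
    obtain ⟨H, hH⟩ := ih (by omega)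
    obtain ⟨H', h1, h2⟩ := exists_layer F.a (n + 1) H
      (fun k y => HH F.a F.g (n + 2) (F.g k) y ∧
        F.d y = θ (Finsupp.single k 1) - H (F.d (Finsupp.single k 1))) (by
        intro k hk
        have hd := F.dH k n hk
        apply F.ex
        · refine HH.sub ?_ ?_
          · rw [← hk]; exact (hθ k (by omega)).1
          · exact HH.map (e := 0) H (fun k hk => hk ▸ (hH k (by omega)).1) hd
        · rw [map_sub, (hθ k (by omega)).2]
          have : θ (F.d (Finsupp.single k 1)) = F.d (H (F.d (Finsupp.single k 1))) + H (F.d (F.d (Finsupp.single k 1))) := 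
            agree θ (F.d ∘ₗ H + H ∘ₗ F.d) (fun k hk => (hH k (by omega)).2) hd
          rw [this, F.dd]; simp
        · intro hn
          omega)
    refine ⟨H', ?_⟩
    intro k hk
    have key : H' (F.d (Finsupp.single k 1)) = H (F.d (Finsupp.single k 1)) := by
      rcases Nat.eq_zero_or_pos (F.a k) with hz | hz
      · rw [(F.ha k).1 hz, F.d0]; simp
      · obtain ⟨p, hp⟩ := Nat.exists_eq_succ_of_ne_zero hz.ne'
        exact agree H' H (fun l hl => h1 l (by omega)) (F.dH k p hp)
    rw [key]
    by_cases hkn : F.a k = n + 1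
    · rw [hkn]
      refine ⟨(h2 k hkn).1, ?_⟩
      rw [(h2 k hkn).2]; simp
    · rw [h1 k hkn]
      exact hH k (by omega)

theorem count_le {I : Ideal (MvPolynomial σ K)} (F G : GRes I) (i j : ℕ)
    [Fintype {k : F.ι // F.a k = i ∧ F.g k = j}] [Fintype {k : G.ι // G.a k = i ∧ G.g k = j}] :
    Fintype.card {k : F.ι // F.a k = i ∧ F.g k = j} ≤
      Fintype.card {k : G.ι // G.a k = i ∧ G.g k = j} := by
  classical
  obtain ⟨φ, hφ0, hφ⟩ := lift_exists G F 1 0 (isHomogeneous_one _ _) (by simp) i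
  obtain ⟨ψ, hψ0, hψ⟩ := lift_exists F G 1 0 (isHomogeneous_one _ _) (by simp) i
  obtain ⟨H, hH⟩ := homotopy_exists F (ψ ∘ₗ φ - LinearMap.id) i (by simp [hφ0, hψ0]) (by
    intro k hk
    constructor
    · refine HH.sub ?_ (HH.single k)
      exact HH.map (e := 0) ψ (fun l hl => hl ▸ (hψ l (by omega)).1) (hφ k hk).1
    · simp only [LinearMap.sub_apply, LinearMap.comp_apply, LinearMap.id_apply, map_sub]
      rw [← (hφ k hk).2]
      congr 1
      exact agree (F.d ∘ₗ ψ) (ψ ∘ₗ G.d) (fun l hl => (hψ l (by omega)).2) (hφ k hk).1) i le_rfl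
  let A : Matrix {k : F.ι // F.a k = i ∧ F.g k = j} {k : G.ι // G.a k = i ∧ G.g k = j} K :=
    fun k m => constantCoeff (φ (Finsupp.single k.1 1) m.1)
  let B : Matrix {k : G.ι // G.a k = i ∧ G.g k = j} {k : F.ι // F.a k = i ∧ F.g k = j} K :=
    fun m l => constantCoeff (ψ (Finsupp.single m.1 1) l.1)
  have hAB : A * B = 1 := by
    ext k l
    obtain ⟨k, hk1, hk2⟩ := k
    obtain ⟨l, hl1, hl2⟩ := l
    have e1 : constantCoeff ((ψ (φ (Finsupp.single k 1))) l) = if k = l then (1 : K) else 0 := by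
      have h := (hH k (by omega)).2
      have h' : ψ (φ (Finsupp.single k 1)) = Finsupp.single k 1 + F.d (H (Finsupp.single k 1)) + H (F.d (Finsupp.single k 1)) := by
        have : ψ (φ (Finsupp.single k 1)) - Finsupp.single k 1 = F.d (H (Finsupp.single k 1)) + H (F.d (Finsupp.single k 1)) := h
        rw [add_assoc, ← this]; abel
      rw [h', Finsupp.add_apply, Finsupp.add_apply, map_add, map_add, F.mn, lin_expand H,
        Finsupp.finsetSum_apply, map_sum, Finset.sum_eq_zero, Finsupp.single_apply]
      · split_ifs <;> simp
      · intro m _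
        simp [F.mn]
    have e2 : constantCoeff ((ψ (φ (Finsupp.single k 1))) l) =
        ∑ m : {k : G.ι // G.a k = i ∧ G.g k = j},
          constantCoeff (φ (Finsupp.single k 1) m.1) * constantCoeff (ψ (Finsupp.single m.1 1) l) := by
      rw [lin_expand ψ, Finsupp.finsetSum_apply, map_sum]
      simp only [Finsupp.smul_apply, smul_eq_mul, map_mul]
      symm
      let u : Finset G.ι := (φ (Finsupp.single k 1)).support ∪
        Finset.univ.map ⟨(Subtype.val : {k : G.ι // G.a k = i ∧ G.g k = j} → G.ι), Subtype.val_injective⟩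
      let w : G.ι → K := fun m =>
        constantCoeff (φ (Finsupp.single k 1) m) * constantCoeff (ψ (Finsupp.single m 1) l)
      refine (Finset.sum_of_injOn (t := u) (g := w) (fun m => m.1)
        (Subtype.val_injective.injOn) ?_ ?_ ?_).trans ?_
      · intro m _
        rw [Finset.mem_coe, Finset.mem_union]
        right; exact Finset.mem_map_of_mem _ (Finset.mem_univ m)
      · intro m _ hm
        by_cases hz : φ (Finsupp.single k 1) m = 0
        · simp [w, hz]
        obtain ⟨h1, r, h2, h3⟩ := (hφ k (by omega)).1 m hz
        have : r ≠ 0 := by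
          intro hr
          apply hm
          refine ⟨⟨m, by omega, by omega⟩, by simp, rfl⟩
        have : constantCoeff (φ (Finsupp.single k 1) m) = 0 := by
          rw [constantCoeff_eq]
          exact h3.coeff_eq_zero (by simpa using this.symm)
        simp [w, this]
      · intro m _; rfl
      · symm
        refine Finset.sum_subset Finset.subset_union_left ?_
        intro m _ hm
        simp [Finsupp.notMem_support_iff.1 hm]
    rw [Matrix.mul_apply, Matrix.one_apply]
    simp only [Subtype.mk.injEq]
    rw [← e1, e2]
  have h1 := Matrix.rank_mul_le_left A B
  rw [hAB, Matrix.rank_one] at h1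
  exact h1.trans (Matrix.rank_le_card_width A)

section cone
variable {α β : Type}

/-- left inclusion -/
noncomputable def Li : (α →₀ MvPolynomial σ K) →ₗ[MvPolynomial σ K] (α ⊕ β →₀ MvPolynomial σ K) :=
  Finsupp.lmapDomain _ _ Sum.inl
/-- right inclusion -/
noncomputable def Ri : (β →₀ MvPolynomial σ K) →ₗ[MvPolynomial σ K] (α ⊕ β →₀ MvPolynomial σ K) :=
  Finsupp.lmapDomain _ _ Sum.inr

@[simp] theorem Li_inl (x : α →₀ MvPolynomial σ K) (l : α) : (Li x : α ⊕ β →₀ _) (Sum.inl l) = x l :=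
  Finsupp.mapDomain_apply Sum.inl_injective _ _
@[simp] theorem Ri_inr (x : β →₀ MvPolynomial σ K) (l : β) : (Ri x : α ⊕ β →₀ _) (Sum.inr l) = x l :=
  Finsupp.mapDomain_apply Sum.inr_injective _ _
@[simp] theorem Li_inr (x : α →₀ MvPolynomial σ K) (l : β) : (Li x : α ⊕ β →₀ _) (Sum.inr l) = 0 :=
  Finsupp.mapDomain_of_notMem_range _ _ (by simp)
@[simp] theorem Ri_inl (x : β →₀ MvPolynomial σ K) (l : α) : (Ri x : α ⊕ β →₀ _) (Sum.inl l) = 0 :=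
  Finsupp.mapDomain_of_notMem_range _ _ (by simp)

theorem sum_decomp (x : α ⊕ β →₀ MvPolynomial σ K) :
    ∃ (y : α →₀ MvPolynomial σ K) (z : β →₀ MvPolynomial σ K), x = Li y + Ri z := by
  refine ⟨(Finsupp.sumFinsuppLEquivProdFinsupp (MvPolynomial σ K) x).1,
    (Finsupp.sumFinsuppLEquivProdFinsupp (MvPolynomial σ K) x).2, ?_⟩
  ext1 l
  rcases l with l | l <;> simp

theorem LR_zero {y : α →₀ MvPolynomial σ K} {z : β →₀ MvPolynomial σ K} (h : Li y + Ri z = 0) :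
    y = 0 ∧ z = 0 := by
  constructor
  · ext1 l
    simpa using DFunLike.congr_fun h (Sum.inl l)
  · ext1 l
    simpa using DFunLike.congr_fun h (Sum.inr l)

/-- cone differential -/
noncomputable def coneD (dF : (α →₀ MvPolynomial σ K) →ₗ[MvPolynomial σ K] (α →₀ MvPolynomial σ K))
    (dG : (β →₀ MvPolynomial σ K) →ₗ[MvPolynomial σ K] (β →₀ MvPolynomial σ K))
    (φ : (β →₀ MvPolynomial σ K) →ₗ[MvPolynomial σ K] (α →₀ MvPolynomial σ K)) :
    (α ⊕ β →₀ MvPolynomial σ K) →ₗ[MvPolynomial σ K] (α ⊕ β →₀ MvPolynomial σ K) :=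
  Finsupp.linearCombination _ (Sum.elim (fun k => Li (dF (Finsupp.single k 1)))
    (fun k => Li (φ (Finsupp.single k 1)) - Ri (dG (Finsupp.single k 1))))

theorem Li_single (k : α) (c : MvPolynomial σ K) :
    (Li (Finsupp.single k c) : α ⊕ β →₀ _) = Finsupp.single (Sum.inl k) c :=
  Finsupp.mapDomain_single
theorem Ri_single (k : β) (c : MvPolynomial σ K) :
    (Ri (Finsupp.single k c) : α ⊕ β →₀ _) = Finsupp.single (Sum.inr k) c :=
  Finsupp.mapDomain_single

variable (dF : (α →₀ MvPolynomial σ K) →ₗ[MvPolynomial σ K] (α →₀ MvPolynomial σ K))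
    (dG : (β →₀ MvPolynomial σ K) →ₗ[MvPolynomial σ K] (β →₀ MvPolynomial σ K))
    (φ : (β →₀ MvPolynomial σ K) →ₗ[MvPolynomial σ K] (α →₀ MvPolynomial σ K))

theorem coneD_L (x : α →₀ MvPolynomial σ K) : coneD dF dG φ (Li x) = Li (dF x) := by
  have : coneD dF dG φ ∘ₗ Li = Li ∘ₗ dF := by
    ext1 k; ext1
    simp only [LinearMap.comp_apply, Finsupp.lsingle_apply, Li_single]
    rw [coneD, Finsupp.linearCombination_single]; simp
  exact LinearMap.congr_fun this x

theorem coneD_R (x : β →₀ MvPolynomial σ K) :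
    coneD dF dG φ (Ri x) = Li (φ x) - Ri (dG x) := by
  have : coneD dF dG φ ∘ₗ Ri = Li ∘ₗ φ - Ri ∘ₗ dG := by
    ext1 k; ext1
    simp only [LinearMap.comp_apply, LinearMap.sub_apply, Finsupp.lsingle_apply, Ri_single]
    rw [coneD, Finsupp.linearCombination_single]; simp
  exact LinearMap.congr_fun this x

variable {a : α → ℕ} {g : α → ℕ} {b : β → ℕ} {g' : β → ℕ} {e : ℕ}

theorem HH_L {p D : ℕ} {x : α →₀ MvPolynomial σ K} (hx : HH a g p D x) :
    HH (Sum.elim a (fun k => b k + 1)) (Sum.elim g (fun k => g' k + e)) p D (Li x) := by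
  rintro (l | l) hl
  · simp only [Li_inl] at hl ⊢; exact hx l hl
  · simp at hl

theorem HH_R {p D : ℕ} {x : β →₀ MvPolynomial σ K} (hx : HH b g' p D x) :
    HH (Sum.elim a (fun k => b k + 1)) (Sum.elim g (fun k => g' k + e)) (p + 1) (D + e) (Ri x) := by
  rintro (l | l) hl
  · simp at hl
  · simp only [Ri_inr] at hl ⊢
    obtain ⟨h1, r, h2, h3⟩ := hx l hl
    exact ⟨by simp [h1], r, by simp; omega, h3⟩

theorem HH_inv {p D : ℕ} {x : α →₀ MvPolynomial σ K} {y : β →₀ MvPolynomial σ K}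
    (h : HH (Sum.elim a (fun k => b k + 1)) (Sum.elim g (fun k => g' k + e)) p D (Li x + Ri y)) :
    HH a g p D x ∧ (y = 0 ∨ ∃ p' D', p = p' + 1 ∧ D = D' + e ∧ HH b g' p' D' y) := by
  constructor
  · intro l hl
    simpa using h (Sum.inl l) (by simpa using hl)
  · by_cases hy : y = 0
    · left; exact hy
    right
    obtain ⟨l, hl⟩ := Finsupp.ne_iff.1 hy
    obtain ⟨h1, r, h2, h3⟩ := h (Sum.inr l) (by simpa using hl)
    simp only [Sum.elim_inr] at h1 h2
    refine ⟨b l, D - e, by omega, by omega, ?_⟩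
    intro m hm
    obtain ⟨h1', r', h2', h3'⟩ := h (Sum.inr m) (by simpa using hm)
    simp only [Sum.elim_inr] at h1' h2'
    exact ⟨by omega, r', by omega, by simpa using h3'⟩

end cone

noncomputable def GRes.cone {I Q : Ideal (MvPolynomial σ K)} (F : GRes I) (G : GRes Q)
    (f : MvPolynomial σ K) (e : ℕ) (hf : f.IsHomogeneous e) (hfQ : ∀ q, q * f ∈ I ↔ q ∈ Q)
    (hne : ∀ k l, F.a l = G.a k → F.g l ≠ G.g k + e)
    (φ : (G.ι →₀ MvPolynomial σ K) →ₗ[MvPolynomial σ K] (F.ι →₀ MvPolynomial σ K))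
    (hφ0 : φ (Finsupp.single G.o 1) = Finsupp.single F.o f)
    (hφ1 : ∀ k, HH F.a F.g (G.a k) (G.g k + e) (φ (Finsupp.single k 1)))
    (hφ2 : ∀ x, F.d (φ x) = φ (G.d x)) : GRes (I ⊔ Ideal.span {f}) where
  ι := F.ι ⊕ G.ι
  a := Sum.elim F.a (fun k => G.a k + 1)
  g := Sum.elim F.g (fun k => G.g k + e)
  o := Sum.inl F.o
  d := coneD F.d G.d φ
  ha := by
    rintro (k | k)
    · simpa using F.ha k
    · simp
  go := F.go
  dH := by
    rintro (k | k) p hp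
    · rw [← Li_single, coneD_L]
      exact HH_L (F.dH k p hp)
    · rw [← Ri_single, coneD_R]
      have hp : G.a k = p := by simpa using hp
      refine HH.sub (HH_L (hp ▸ hφ1 k)) ?_
      rcases Nat.eq_zero_or_pos p with hz | hz
      · rw [(G.ha k).1 (by omega), G.d0, map_zero]; exact HH.zero
      · obtain ⟨p', rfl⟩ := Nat.exists_eq_succ_of_ne_zero hz.ne'
        exact HH_R (G.dH k p' hp)
  d0 := by rw [← Li_single, coneD_L, F.d0, map_zero]
  dd := by
    intro x
    obtain ⟨y, z, rfl⟩ := sum_decomp x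
    simp only [map_add, coneD_L, coneD_R, map_sub, F.dd, G.dd, map_zero, hφ2]
    simp
  dI := by
    intro x
    obtain ⟨y, z, rfl⟩ := sum_decomp x
    simp only [map_add, coneD_L, coneD_R, Finsupp.add_apply, Finsupp.sub_apply, Li_inl, Ri_inl, sub_zero]
    refine add_mem (Ideal.mem_sup_left (F.dI y)) (Ideal.mem_sup_right ?_)
    rw [lin_expand φ, Finsupp.finsetSum_apply]
    refine sum_mem fun k _ => ?_
    by_cases hk : k = G.o
    · subst hk
      rw [hφ0]
      simpa using Ideal.mul_mem_left _ _ (Ideal.mem_span_singleton_self f)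
    · have : φ (Finsupp.single k 1) F.o = 0 := by
        by_contra h
        have h1 := (hφ1 k F.o h).1
        rw [(F.ha F.o).2 rfl] at h1
        exact hk ((G.ha k).1 h1.symm)
      simp [this]
  ex := by
    intro p D x hx hdx hx0
    obtain ⟨x, y, rfl⟩ := sum_decomp x
    obtain ⟨hx1, hy⟩ := HH_inv hx
    rw [map_add, coneD_L, coneD_R] at hdx
    obtain ⟨h1, h2⟩ := LR_zero (y := F.d x + φ y) (z := - G.d y) (by rw [← hdx, map_add, map_neg]; abel)
    rw [neg_eq_zero] at h2
    rcases hy with rfl | ⟨p', D', rfl, rfl, hy⟩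
    · rcases Nat.eq_zero_or_pos p with hz | hz
      · subst hz
        have h3 := hx0 rfl
        rw [map_zero, add_zero, Li_inl, Submodule.mem_sup] at h3
        obtain ⟨q, hq, w, hw, h4⟩ := h3
        obtain ⟨r, rfl⟩ := Ideal.mem_span_singleton'.1 hw
        have h5 : x F.o = homogeneousComponent D q + cmpt D e r * f := by
          rw [← hc_mul _ _ _ _ hf, ← map_add, h4]
          refine (cmpt_self D 0 (x F.o) fun h => ?_).symm
          obtain ⟨-, r, h6, h7⟩ := hx1 F.o h
          exact ⟨r, by rw [← h6, F.go], h7⟩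
        obtain ⟨y', hy', hdy'⟩ := F.ex 0 D (Finsupp.single F.o (homogeneousComponent D q)) (by
          have := HH.smul (homogeneousComponent_isHomogeneous D q) (HH.single (a := F.a) (g := F.g) F.o)
          rw [F.go, (F.ha F.o).2 rfl] at this
          simpa using this) (by
          have : (Finsupp.single F.o (homogeneousComponent D q)) = homogeneousComponent D q • (Finsupp.single F.o 1) := by simp
          rw [this, map_smul, F.d0, smul_zero]) (by
          intro _; simpa using F.hI q hq D)
        refine ⟨Li y' + Ri (Finsupp.single G.o (cmpt D e r)), ?_, ?_⟩
        · refine HH.add (HH_L hy') ?_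
          by_cases hz : cmpt D e r = 0
          · rw [hz]; simp [HH.zero]
          obtain ⟨m, h6, h7⟩ := cmpt_hom D e r hz
          have := HH.smul h7 (HH.single (a := G.a) (g := G.g) G.o)
          rw [G.go, (G.ha G.o).2 rfl] at this
          have := HH_R (a := F.a) (g := F.g) (e := e) this
          simpa [h6] using this
        · rw [map_add, coneD_L, coneD_R, hdy']
          have : (Finsupp.single G.o (cmpt D e r)) = cmpt D e r • (Finsupp.single G.o 1) := by simp
          rw [this, map_smul, map_smul, map_smul, G.d0, smul_zero, map_zero, sub_zero, hφ0, add_zero,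
            ← map_smul, ← map_add]
          congr 1
          rw [F.H0 hx1, h5]
          simp
      · obtain ⟨y', hy', hdy'⟩ := F.ex p D x hx1 (by simpa using h1) (by omega)
        exact ⟨Li y', HH_L hy', by rw [coneD_L, hdy']; simp⟩
    · obtain ⟨y', hy', hdy'⟩ := G.ex p' D' y hy h2 (by
        intro hp
        subst hp
        rw [← hfQ]
        have h3 : F.d x = - φ y := eq_neg_of_add_eq_zero_left h1
        have h4 := F.dI x
        rw [h3, G.H0 hy] at h4
        have : (Finsupp.single G.o (y G.o)) = y G.o • (Finsupp.single G.o 1) := by simp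
        rw [this, map_smul, hφ0] at h4
        simpa using h4)
      have hφy : HH F.a F.g (p' + 1) (D' + e) (φ y') :=
        HH.map φ (fun k hk => hk ▸ hφ1 k) hy'
      obtain ⟨x', hx', hdx'⟩ := F.ex (p' + 1) (D' + e) (x + φ y') (hx1.add hφy) (by
        rw [map_add, hφ2, hdy', h1]) (by omega)
      refine ⟨Li x' - Ri y', (HH_L hx').sub (HH_R hy'), ?_⟩
      rw [map_sub, coneD_L, coneD_R, hdx', hdy', map_add]
      abel
  hI := by
    intro q hq D
    rw [Submodule.mem_sup] at hq
    obtain ⟨q, hq, w, hw, rfl⟩ := hq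
    obtain ⟨r, rfl⟩ := Ideal.mem_span_singleton'.1 hw
    rw [map_add, hc_mul _ _ _ _ hf]
    exact add_mem (Ideal.mem_sup_left (F.hI q hq D))
      (Ideal.mem_sup_right (Ideal.mul_mem_left _ _ (Ideal.mem_span_singleton_self f)))
  mn := by
    intro x l
    obtain ⟨y, z, rfl⟩ := sum_decomp x
    rw [map_add, coneD_L, coneD_R]
    rcases l with l | l
    · simp only [Finsupp.add_apply, Finsupp.sub_apply, Li_inl, Ri_inl, sub_zero, map_add, F.mn, zero_add]
      rw [lin_expand φ, Finsupp.finsetSum_apply, map_sum]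
      refine Finset.sum_eq_zero fun k _ => ?_
      have : constantCoeff (φ (Finsupp.single k 1) l) = 0 := by
        by_cases hz : φ (Finsupp.single k 1) l = 0
        · simp [hz]
        obtain ⟨h1, r, h2, h3⟩ := hφ1 k l hz
        have := hne k l h1
        rw [constantCoeff_eq]
        exact h3.coeff_eq_zero (by simp; omega)
      simp [this]
    · simp [G.mn]

/-- existence of a finite minimal resolution with prescribed counts -/
def HasRes (I : Ideal (MvPolynomial σ K)) (c : ℕ → ℕ → ℕ) : Prop :=
  ∃ (F : GRes I) (_ : Fintype F.ι), ∀ i j, (Finset.univ.filter fun k => F.a k = i ∧ F.g k = j).card = c i j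

/-- shifted count -/
def shiftC (e : ℕ) (c : ℕ → ℕ → ℕ) (i j : ℕ) : ℕ :=
  if 1 ≤ i ∧ e ≤ j then c (i - 1) (j - e) else 0

theorem HasRes.cone {I Q : Ideal (MvPolynomial σ K)} {c c' : ℕ → ℕ → ℕ} (hF : HasRes I c) (hG : HasRes Q c')
    (f : MvPolynomial σ K) (e : ℕ) (hf : f.IsHomogeneous e) (hfQ : ∀ q, q * f ∈ I ↔ q ∈ Q)
    (hne : ∀ i j, c' i j ≠ 0 → c i (j + e) = 0) :
    HasRes (I ⊔ Ideal.span {f}) (fun i j => c i j + shiftC e c' i j) := by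
  classical
  obtain ⟨F, _, hF⟩ := hF
  obtain ⟨G, _, hG⟩ := hG
  obtain ⟨φ, h0, h1⟩ := lift_exists F G f e hf (fun q => (hfQ q).2) (Finset.univ.sup G.a)
  have hb : ∀ k, G.a k ≤ Finset.univ.sup G.a := fun k => Finset.le_sup (Finset.mem_univ k)
  refine ⟨GRes.cone F G f e hf hfQ ?_ φ h0 (fun k => (h1 k (hb k)).1) ?_, ?_, ?_⟩
  · intro k l h2 h3
    have e1 : c' (G.a k) (G.g k) ≠ 0 := by
      rw [← hG]
      exact (Finset.card_pos.2 ⟨k, by simp⟩).ne'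
    have e2 : c (G.a k) (G.g k + e) ≠ 0 := by
      rw [← hF]
      exact (Finset.card_pos.2 ⟨l, by simp [h2, h3]⟩).ne'
    exact e2 (hne _ _ e1)
  · have : F.d ∘ₗ φ = φ ∘ₗ G.d := by
      ext1 k; ext1
      exact (h1 k (hb k)).2
    exact LinearMap.congr_fun this
  · exact inferInstanceAs (Fintype (F.ι ⊕ G.ι))
  · intro i j
    change (Finset.univ.filter fun k : F.ι ⊕ G.ι => Sum.elim F.a (fun k => G.a k + 1) k = i ∧
      Sum.elim F.g (fun k => G.g k + e) k = j).card = _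
    rw [Finset.card_filter, Fintype.sum_sum_type, ← Finset.card_filter, ← Finset.card_filter]
    congr 1
    · exact hF i j
    · unfold shiftC
      split_ifs with h
      · rw [← hG]
        congr 1
        ext k
        rw [Finset.mem_filter, Finset.mem_filter]
        simp only [Finset.mem_univ, true_and, Sum.elim_inr]
        omega
      · rw [Finset.card_eq_zero]
        ext k
        rw [Finset.mem_filter]
        simp only [Finset.mem_univ, true_and, Sum.elim_inr, Finset.notMem_empty, iff_false]
        omega

theorem hasRes_bot : HasRes (⊥ : Ideal (MvPolynomial σ K)) (fun i j => if i = 0 ∧ j = 0 then 1 else 0) := by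
  let F : GRes (⊥ : Ideal (MvPolynomial σ K)) := {
    ι := Unit
    a := fun _ => 0
    g := fun _ => 0
    o := ()
    d := 0
    ha := by simp
    go := rfl
    dH := by simp
    d0 := rfl
    dd := by simp
    dI := by simp
    ex := by
      intro p D x hx _ h0
      refine ⟨0, HH.zero, ?_⟩
      by_contra h
      obtain ⟨l, hl⟩ := Finsupp.ne_iff.1 h
      have h1 := (hx l (fun h' => hl (by simp [h']))).1
      have h2 := h0 h1.symm
      exact hl (by simpa using h2.symm)
    hI := by
      intro q hq D
      rw [Ideal.mem_bot] at hq ⊢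
      simp [hq]
    mn := by simp }
  refine ⟨F, inferInstanceAs (Fintype Unit), ?_⟩
  · intro i j
    change (Finset.univ.filter fun k : Unit => 0 = i ∧ 0 = j).card = _
    simp only [eq_comm (a := (0 : ℕ))]
    split_ifs with h
    · simp [h]
    · simp [h]

theorem HasRes.congr {I I' : Ideal (MvPolynomial σ K)} {c c' : ℕ → ℕ → ℕ} (h : HasRes I c) (hI : I = I')
    (hc : ∀ i j, c i j = c' i j) : HasRes I' c' := by
  subst hI
  obtain ⟨F, hF, h⟩ := h
  exact ⟨F, hF, fun i j => (h i j).trans (hc i j)⟩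

variable (K) in
/-- monomial ideal -/
noncomputable def MI (S : Set (σ →₀ ℕ)) : Ideal (MvPolynomial σ K) :=
  Ideal.span ((fun s => monomial s (1 : K)) '' S)

theorem MI_insert (m : σ →₀ ℕ) (S : Set (σ →₀ ℕ)) :
    MI K (insert m S) = MI K S ⊔ Ideal.span {monomial m (1 : K)} := by
  rw [MI, MI, Set.image_insert_eq, Ideal.span_insert, sup_comm]

theorem MI_colon (m : σ →₀ ℕ) (S T : Set (σ →₀ ℕ)) (h1 : ∀ t ∈ T, ∃ s ∈ S, s ≤ t + m)
    (h2 : ∀ s ∈ S, ∃ t ∈ T, t ≤ s - m) (q : MvPolynomial σ K) :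
    q * monomial m (1 : K) ∈ MI K S ↔ q ∈ MI K T := by
  rw [MI, MI, mem_ideal_span_monomial_image, mem_ideal_span_monomial_image]
  constructor
  · intro h x hx
    obtain ⟨s, hs, h3⟩ := h (x + m) (by
      rw [mem_support_iff, coeff_mul_monomial, mul_one]
      exact mem_support_iff.1 hx)
    obtain ⟨t, ht, h4⟩ := h2 s hs
    exact ⟨t, ht, h4.trans (tsub_le_iff_right.2 h3)⟩
  · intro h x hx
    rw [mem_support_iff, coeff_mul_monomial'] at hx
    split_ifs at hx with hm
    · obtain ⟨t, ht, h4⟩ := h (x - m) (by rw [mem_support_iff]; simpa using hx)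
      obtain ⟨s, hs, h5⟩ := h1 t ht
      refine ⟨s, hs, h5.trans ?_⟩
      calc t + m ≤ (x - m) + m := by gcongr
        _ = x := tsub_add_cancel_of_le hm
    · exact absurd rfl hx

theorem HasRes.step {S T : Set (σ →₀ ℕ)} {c c' : ℕ → ℕ → ℕ} (hF : HasRes (MI K S) c)
    (hG : HasRes (MI K T) c') (m : σ →₀ ℕ) (h1 : ∀ t ∈ T, ∃ s ∈ S, s ≤ t + m)
    (h2 : ∀ s ∈ S, ∃ t ∈ T, t ≤ s - m) (e : ℕ) (he : m.degree = e)
    (hne : ∀ i j, c' i j ≠ 0 → c i (j + e) = 0) :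
    HasRes (MI K (insert m S)) (fun i j => c i j + shiftC e c' i j) := by
  rw [MI_insert]
  exact hF.cone hG _ e (isHomogeneous_monomial _ he) (MI_colon m S T h1 h2) hne

theorem le_tsub_of_disj {t s m : σ →₀ ℕ} (h : t ≤ s) (hd : ∀ x, t x ≠ 0 → m x = 0) : t ≤ s - m := by
  intro x
  have := h x
  by_cases h0 : t x = 0
  · simp [h0]
  · simp only [Finsupp.tsub_apply, hd x h0]
    simpa using this

theorem hasRes_koszul {V : Type} (y : V → (σ →₀ ℕ)) (ℓ : ℕ) (hℓ : 1 ≤ ℓ) (A : Finset V)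
    (hdeg : ∀ v ∈ A, (y v).degree = ℓ)
    (hd : ∀ v ∈ A, ∀ w ∈ A, v ≠ w → ∀ x, y v x ≠ 0 → y w x = 0) :
    HasRes (MI K (y '' A)) (fun i j => if j = ℓ * i then A.card.choose i else 0) := by
  classical
  induction A using Finset.induction_on with
  | empty =>
    refine hasRes_bot.congr (by simp [MI]) ?_
    intro i j
    rcases i with _ | i
    · simp
    · simp
  | insert v A hv ih =>
    have ih := ih (fun w hw => hdeg w (by simp [hw]))
      (fun w hw w' hw' => hd w (by simp [hw]) w' (by simp [hw']))
    have := ih.step ih (y v) (fun t ht => ⟨t, ht, by simp⟩) (by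
      rintro s ⟨w, hw, rfl⟩
      refine ⟨y w, ⟨w, hw, rfl⟩, le_tsub_of_disj le_rfl ?_⟩
      exact hd w (by simp_all) v (by simp) (by rintro rfl; exact hv hw)) ℓ (hdeg v (by simp)) (by
      intro i j hj
      have : j = ℓ * i := by by_contra h; exact hj (if_neg h)
      rw [if_neg]; omega)
    refine this.congr (by rw [Finset.coe_insert, Set.image_insert_eq]) ?_
    intro i j
    rw [Finset.card_insert_of_notMem hv]
    unfold shiftC
    rcases i with _ | i
    · simp
    · have e1 : ℓ * (i + 1) = ℓ * i + ℓ := by ring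
      by_cases h : j = ℓ * (i + 1)
      · rw [if_pos h, if_pos h, if_pos (by omega)]
        simp only [add_tsub_cancel_right]
        rw [if_pos (by omega)]
        rw [Nat.choose_succ_succ, add_comm]
      · rw [if_neg h, if_neg h]
        by_cases h' : 1 ≤ i + 1 ∧ ℓ ≤ j
        · rw [if_pos h']
          simp only [add_tsub_cancel_right]
          rw [if_neg (by omega)]
        · rw [if_neg h']

/-- expected counts -/
def cnt (ℓ E : ℕ) (A B : ℕ → ℕ) : ℕ → ℕ → ℕ
  | 0, j => if j = 0 then 1 else 0
  | i + 1, j => (if j = ℓ * (i + 2) then A i else 0) + (if j = ℓ * (i + 2) + E then B i else 0)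

theorem step1 {V : Type} (y : V → (σ →₀ ℕ)) (ℓ E : ℕ) (hℓ : 1 ≤ ℓ) (X : Finset V)
    (hdeg : ∀ v ∈ X, (y v).degree = ℓ)
    (hd : ∀ v ∈ X, ∀ w ∈ X, v ≠ w → ∀ x, y v x ≠ 0 → y w x = 0)
    {S : Set (σ →₀ ℕ)} {A : ℕ → ℕ}
    (hF : HasRes (MI K S) (cnt ℓ E A 0)) (m : σ →₀ ℕ) (hm : m.degree = 2 * ℓ)
    (h1 : ∀ v ∈ X, ∃ s ∈ S, s ≤ y v + m)
    (h2 : ∀ s ∈ S, ∃ v ∈ X, y v ≤ s - m) :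
    HasRes (MI K (insert m S)) (cnt ℓ E (fun i => A i + X.card.choose i) 0) := by
  have := hF.step (hasRes_koszul y ℓ hℓ X hdeg hd) m (by simpa using h1) (by simpa using h2) (2 * ℓ) hm (by
    intro i j hj
    have : j = ℓ * i := by by_contra h; exact hj (if_neg h)
    rcases i with _ | i
    · simp [cnt]; omega
    · have e1 : ℓ * (i + 1) = ℓ * i + ℓ := by ring
      have e2 : ℓ * (i + 2) = ℓ * i + 2 * ℓ := by ring
      simp only [cnt, Pi.zero_apply, ite_self, add_zero]
      rw [if_neg]; omega)
  refine this.congr rfl ?_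
  intro i j
  rcases i with _ | i
  · simp [cnt, shiftC]
  · simp only [cnt, shiftC, Pi.zero_apply, ite_self, add_zero]
    have e2 : ℓ * (i + 2) = ℓ * i + 2 * ℓ := by ring
    simp only [add_tsub_cancel_right]
    by_cases h : j = ℓ * (i + 2)
    · rw [if_pos h, if_pos h, if_pos (by omega), if_pos (by omega)]
    · rw [if_neg h, if_neg h]
      split_ifs <;> omega

theorem step2 {V : Type} (y : V → (σ →₀ ℕ)) (ℓ E : ℕ) (hℓ : 1 ≤ ℓ) (X : Finset V)
    (hdeg : ∀ v ∈ X, (y v).degree = ℓ)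
    (hd : ∀ v ∈ X, ∀ w ∈ X, v ≠ w → ∀ x, y v x ≠ 0 → y w x = 0)
    {S : Set (σ →₀ ℕ)} {A B : ℕ → ℕ}
    (hF : HasRes (MI K S) (cnt ℓ E A B)) (m : σ →₀ ℕ) (hm : m.degree = 2 * ℓ + E)
    (h1 : ∀ v ∈ X, ∃ s ∈ S, s ≤ y v + m)
    (h2 : ∀ s ∈ S, ∃ v ∈ X, y v ≤ s - m) :
    HasRes (MI K (insert m S)) (cnt ℓ E A (fun i => B i + X.card.choose i)) := by
  have := hF.step (hasRes_koszul y ℓ hℓ X hdeg hd) m (by simpa using h1) (by simpa using h2) (2 * ℓ + E) hm (by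
    intro i j hj
    have : j = ℓ * i := by by_contra h; exact hj (if_neg h)
    rcases i with _ | i
    · simp [cnt]; omega
    · have e1 : ℓ * (i + 1) = ℓ * i + ℓ := by ring
      have e2 : ℓ * (i + 2) = ℓ * i + 2 * ℓ := by ring
      simp only [cnt]
      rw [if_neg, if_neg] <;> omega)
  refine this.congr rfl ?_
  intro i j
  rcases i with _ | i
  · simp [cnt, shiftC]
  · simp only [cnt, shiftC]
    have e2 : ℓ * (i + 2) = ℓ * i + 2 * ℓ := by ring
    simp only [add_tsub_cancel_right]
    rw [add_assoc]
    congr 1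
    by_cases h : j = ℓ * (i + 2) + E
    · rw [if_pos h, if_pos h, if_pos (by omega), if_pos (by omega)]
    · rw [if_neg h, if_neg h]
      split_ifs <;> omega

theorem hockey (p i m : ℕ) : ∑ a ∈ Finset.range m, (p + a).choose i + p.choose (i + 1) = (p + m).choose (i + 1) := by
  induction m with
  | zero => simp
  | succ m ih =>
    rw [Finset.sum_range_succ, ← add_assoc p m 1, Nat.choose_succ_succ, ← ih]; ring

theorem final_count (h i : ℕ) (hh : 1 ≤ h) :
    ∑ c ∈ Finset.range h, ∑ a ∈ Finset.range (h - c), (h - 1 + a).choose i =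
      (2 * h).choose (i + 2) - (i + 3) * h.choose (i + 2) := by
  rw [← Finset.sum_range_reflect]
  obtain ⟨h, rfl⟩ : ∃ n, h = n + 1 := ⟨h - 1, by omega⟩
  have e1 : ∑ c ∈ Finset.range (h + 1), ∑ a ∈ Finset.range (h + 1 - (h + 1 - 1 - c)), (h + 1 - 1 + a).choose i
      + (h + 1) * h.choose (i + 1) = ∑ c ∈ Finset.range (h + 1), (h + 1 + c).choose (i + 1) := by
    have e0 : (h + 1) * h.choose (i + 1) = ∑ c ∈ Finset.range (h + 1), h.choose (i + 1) := by simp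
    rw [e0, ← Finset.sum_add_distrib]
    refine Finset.sum_congr rfl fun c hc => ?_
    rw [Finset.mem_range] at hc
    rw [show h + 1 - (h + 1 - 1 - c) = c + 1 by omega, show h + 1 - 1 = h by omega, hockey]
    congr 1; omega
  have e2 := hockey (h + 1) (i + 1) (h + 1)
  have e3 := Nat.add_one_mul_choose_eq h (i + 1)
  rw [show h + 1 + (h + 1) = 2 * (h + 1) by ring] at e2
  have e4 : (i + 3) * (h + 1).choose (i + 2) = (h + 1).choose (i + 1 + 1) * (i + 1 + 1) + (h + 1).choose (i + 2) := by ring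
  rw [e4]
  change _ = (2 * (h + 1)).choose (i + 1 + 1) - _
  rw [← e3, ← e2]
  have e5 : (h + 1).choose (i + 1 + 1) = (h + 1).choose (i + 2) := rfl
  omega

theorem final_count1 (n i : ℕ) :
    (i + 1) * n.choose (i + 2) + n * (n - 1).choose i = (i + 1) * (n + 1).choose (i + 2) := by
  rcases n with _ | n
  · simp [Nat.choose_eq_zero_of_lt]
  · have := Nat.add_one_mul_choose_eq n i
    rw [add_tsub_cancel_right, this, Nat.choose_succ_succ (n + 1) (i + 1)]; ring

section conv

theorem proj_lem {n : ℕ} (T : (Fin n → MvPolynomial σ K) →ₗ[MvPolynomial σ K] MvPolynomial σ K)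
    (gk : Fin n → ℕ) (g' D : ℕ)
    (hT : ∀ k, T (Pi.single k 1) ≠ 0 → ∃ r, r + g' = gk k ∧ (T (Pi.single k 1)).IsHomogeneous r)
    (w : Fin n → MvPolynomial σ K) :
    T (fun k => cmpt D (gk k) (w k)) = cmpt D g' (T w) := by
  rw [LinearMap.pi_apply_eq_sum_univ T w, cmpt_sum, LinearMap.pi_apply_eq_sum_univ T]
  refine Finset.sum_congr rfl fun k _ => ?_
  have e : (fun j => if k = j then (1 : MvPolynomial σ K) else 0) = Pi.single k 1 := by
    ext1 j; simp [Pi.single_apply, eq_comm]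
  rw [e, smul_eq_mul, smul_eq_mul, cmpt_mul D g' (gk k) _ _ (hT k)]

variable (N : ℕ → ℕ)

/-- inclusion of a layer -/
noncomputable def inc (i : ℕ) : (Fin (N i) → MvPolynomial σ K) →ₗ[MvPolynomial σ K]
    (Option (Σ i, Fin (N i)) →₀ MvPolynomial σ K) :=
  Fintype.linearCombination (MvPolynomial σ K) (fun l => Finsupp.single (some ⟨i, l⟩) 1)

theorem inc_none (i : ℕ) (v : Fin (N i) → MvPolynomial σ K) : inc N i v none = 0 := by
  simp [inc, Fintype.linearCombination_apply, Finsupp.finsetSum_apply]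

theorem inc_self (i : ℕ) (v : Fin (N i) → MvPolynomial σ K) (l) : inc N i v (some ⟨i, l⟩) = v l := by
  classical
  simp [inc, Fintype.linearCombination_apply, Finsupp.finsetSum_apply, Finsupp.single_apply]

theorem inc_ne (i j : ℕ) (v : Fin (N i) → MvPolynomial σ K) (l) (h : j ≠ i) : inc N i v (some ⟨j, l⟩) = 0 := by
  classical
  simp only [inc, Fintype.linearCombination_apply, Finsupp.finsetSum_apply]
  refine Finset.sum_eq_zero fun k _ => ?_
  rw [Finsupp.smul_apply, Finsupp.single_eq_of_ne, smul_zero]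
  rintro h'
  simp at h'
  exact h h'.1

theorem inc_single (i : ℕ) (k : Fin (N i)) :
    inc N i (Pi.single k (1 : MvPolynomial σ K)) = Finsupp.single (some ⟨i, k⟩) 1 := by
  classical
  simp [inc]

/-- homological degree -/
def oa : Option (Σ i, Fin (N i)) → ℕ
  | none => 0
  | some x => x.1 + 1

/-- internal degree -/
def og (g : (i : ℕ) → Fin (N i) → ℕ) : Option (Σ i, Fin (N i)) → ℕ
  | none => 0
  | some x => g x.1 x.2

theorem HH_inc {g : (i : ℕ) → Fin (N i) → ℕ} {i D : ℕ} {v : Fin (N i) → MvPolynomial σ K}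
    (hv : ∀ l, v l ≠ 0 → ∃ r, r + g i l = D ∧ (v l).IsHomogeneous r) :
    HH (oa N) (og N g) (i + 1) D (inc N i v) := by
  rintro (_ | ⟨j, l⟩) hl
  · exact absurd (inc_none N i v) hl
  · by_cases h : j = i
    · subst h
      rw [inc_self] at hl ⊢
      exact ⟨rfl, hv l hl⟩
    · exact absurd (inc_ne N i j v l h) hl

theorem eq_inc {g : (i : ℕ) → Fin (N i) → ℕ} {i D : ℕ} {x : Option (Σ i, Fin (N i)) →₀ MvPolynomial σ K}
    (hx : HH (oa N) (og N g) (i + 1) D x) : x = inc N i (fun l => x (some ⟨i, l⟩)) := by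
  ext1 m
  rcases m with _ | ⟨j, l⟩
  · rw [inc_none]
    by_contra h
    have := (hx _ h).1
    simp [oa] at this
  · by_cases h : j = i
    · subst h; rw [inc_self]
    · rw [inc_ne _ _ _ _ _ h]
      by_contra h'
      have := (hx _ h').1
      simp [oa] at this
      exact h this

variable {J : Ideal (MvPolynomial σ K)} (res : MinFreeResOfIdeal J)

/-- values of the differential -/
noncomputable def dval : Option (Σ i, Fin (res.N i)) → (Option (Σ i, Fin (res.N i)) →₀ MvPolynomial σ K)
  | none => 0
  | some ⟨0, k⟩ => Finsupp.single none (res.ε (Pi.single k 1))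
  | some ⟨i + 1, k⟩ => inc res.N i (res.d i (Pi.single k 1))

/-- total differential -/
noncomputable def td : (Option (Σ i, Fin (res.N i)) →₀ MvPolynomial σ K) →ₗ[MvPolynomial σ K]
    (Option (Σ i, Fin (res.N i)) →₀ MvPolynomial σ K) :=
  Finsupp.linearCombination _ (dval res)

theorem td_single (k) : td res (Finsupp.single k 1) = dval res k := by
  simp [td]

theorem td_none (c : MvPolynomial σ K) : td res (Finsupp.single none c) = 0 := by
  simp [td, dval]

theorem td_inc0 (v) : td res (inc res.N 0 v) = Finsupp.single none (res.ε v) := by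
  have : td res ∘ₗ inc res.N 0 = Finsupp.lsingle none ∘ₗ res.ε := by
    refine LinearMap.pi_ext' fun k => ?_
    ext1
    simp only [LinearMap.comp_apply, LinearMap.single_apply, inc_single, td_single, Finsupp.lsingle_apply]
    rfl
  exact LinearMap.congr_fun this v

theorem td_inc (i : ℕ) (v) : td res (inc res.N (i + 1) v) = inc res.N i (res.d i v) := by
  have : td res ∘ₗ inc res.N (i + 1) = inc res.N i ∘ₗ res.d i := by
    refine LinearMap.pi_ext' fun k => ?_
    ext1
    simp only [LinearMap.comp_apply, LinearMap.single_apply, inc_single, td_single]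
    rfl
  exact LinearMap.congr_fun this v

theorem res_deg (i : ℕ) (k : Fin (res.N (i + 1))) (l : Fin (res.N i))
    (h : res.d i (Pi.single k 1) l ≠ 0) :
    ∃ r, r ≠ 0 ∧ r + res.g i l = res.g (i + 1) k ∧ (res.d i (Pi.single k 1) l).IsHomogeneous r := by
  have := res.hdeg i k l
  split_ifs at this with h1
  · exact ⟨_, by omega, by omega, this⟩
  · exact absurd this h

theorem inc_inj (i : ℕ) (v : Fin (res.N i) → MvPolynomial σ K) (h : inc res.N i v = 0) : v = 0 := by
  ext1 l
  rw [← inc_self res.N i v l, h]; rfl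

theorem d_of_range (i : ℕ) (w) : td res (td res (inc res.N i w)) = 0 := by
  rcases i with _ | _ | i
  · rw [td_inc0, td_none]
  · rw [td_inc, td_inc0]
    have : res.d 0 w ∈ LinearMap.ker res.ε := by rw [res.hker]; exact ⟨w, rfl⟩
    rw [LinearMap.mem_ker.1 this]; simp
  · rw [td_inc, td_inc]
    have : res.d (i + 1) w ∈ LinearMap.ker (res.d i) := by rw [← res.hexact]; exact ⟨w, rfl⟩
    rw [LinearMap.mem_ker.1 this]; simp

noncomputable def toGRes (hcc : ∀ q ∈ J, constantCoeff q = 0)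
    (hJ : ∀ q ∈ J, ∀ D, homogeneousComponent D q ∈ J) : GRes J where
  ι := Option (Σ i, Fin (res.N i))
  a := oa res.N
  g := og res.N res.g
  o := none
  d := td res
  ha := by rintro (_ | ⟨i, k⟩) <;> simp [oa]
  go := rfl
  dH := by
    rintro (_ | ⟨i, k⟩) p hp
    · simp [oa] at hp
    · have hp : i = p := by simpa [oa] using hp
      subst hp
      rw [td_single]
      rcases i with _ | i
      · rintro (_ | l) hl
        · refine ⟨rfl, res.g 0 k, by simp [og], ?_⟩
          simp only [dval, Finsupp.single_eq_same]
          exact res.hεdeg k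
        · exact absurd (Finsupp.single_eq_of_ne (by simp)) hl
      · refine HH_inc _ fun l hl => ?_
        obtain ⟨r, _, h1, h2⟩ := res_deg res i k l hl
        exact ⟨r, h1, h2⟩
  d0 := td_none res 1
  dd := by
    intro x
    rw [lin_expand (td res) x, map_sum]
    refine Finset.sum_eq_zero fun k _ => ?_
    rw [map_smul]
    rcases k with _ | ⟨i, k⟩
    · rw [td_none, map_zero, smul_zero]
    · rw [← inc_single, d_of_range, smul_zero]
  dI := by
    intro x
    rw [lin_expand, Finsupp.finsetSum_apply]
    refine sum_mem fun k _ => ?_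
    rw [Finsupp.smul_apply, smul_eq_mul]
    refine Ideal.mul_mem_left _ _ ?_
    rcases k with _ | ⟨i, k⟩
    · rw [td_none]; simp
    · rw [← inc_single]
      rcases i with _ | i
      · rw [td_inc0, Finsupp.single_eq_same]
        exact res.hrange.le ⟨_, rfl⟩
      · rw [td_inc, inc_none]; simp
  ex := by
    intro p D x hx hdx h0
    rcases p with _ | i
    · have hx0 : x = Finsupp.single none (x none) := by
        ext1 l
        rcases l with _ | l
        · simp
        · rw [Finsupp.single_eq_of_ne (by simp)]
          by_contra h
          have := (hx _ h).1
          simp [oa] at this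
      have h1 := h0 rfl
      have h2 : x none ∈ LinearMap.range res.ε := by rw [res.hrange]; exact h1
      obtain ⟨w, hw⟩ := h2
      refine ⟨inc res.N 0 (fun k => cmpt D (res.g 0 k) (w k)), HH_inc _ fun l hl => cmpt_hom _ _ _ hl, ?_⟩
      rw [td_inc0, proj_lem res.ε (res.g 0) 0 D (fun k _ => ⟨res.g 0 k, rfl, res.hεdeg k⟩), hw, cmpt_self]
      · exact hx0.symm
      · intro h; exact (hx none h).2
    · have hxi := eq_inc res.N hx
      have h1 : (fun l => x (some ⟨i, l⟩)) ∈ LinearMap.range (res.d i) := by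
        rcases i with _ | i
        · rw [← res.hker, LinearMap.mem_ker]
          rw [hxi, td_inc0] at hdx
          simpa using hdx
        · rw [res.hexact, LinearMap.mem_ker]
          rw [hxi, td_inc] at hdx
          exact inc_inj res i _ hdx
      obtain ⟨w, hw⟩ := h1
      refine ⟨inc res.N (i + 1) (fun k => cmpt D (res.g (i + 1) k) (w k)), HH_inc _ fun l hl => cmpt_hom _ _ _ hl, ?_⟩
      rw [td_inc]
      conv_rhs => rw [hxi]
      congr 1
      ext1 l
      have h2 := proj_lem (LinearMap.proj l ∘ₗ res.d i) (res.g (i + 1)) (res.g i l) D (fun k hk => by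
        obtain ⟨r, _, h1, h2⟩ := res_deg res i k l hk
        exact ⟨r, h1, h2⟩) w
      simp only [LinearMap.comp_apply, LinearMap.proj_apply, hw] at h2
      rw [h2, cmpt_self]
      intro h; exact (hx _ h).2
  hI := hJ
  mn := by
    intro x l
    rw [lin_expand, Finsupp.finsetSum_apply, map_sum]
    refine Finset.sum_eq_zero fun k _ => ?_
    rw [Finsupp.smul_apply, smul_eq_mul, map_mul]
    refine mul_eq_zero_of_right _ ?_
    rcases k with _ | ⟨i, k⟩
    · rw [td_none]; simp
    · rw [← inc_single]
      rcases i with _ | i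
      · rw [td_inc0]
        rcases l with _ | l
        · rw [Finsupp.single_eq_same]
          apply hcc
          exact res.hrange.le ⟨_, rfl⟩
        · rw [Finsupp.single_eq_of_ne (by simp)]; simp
      · rw [td_inc]
        rcases l with _ | ⟨j, l⟩
        · rw [inc_none]; simp
        · by_cases h : j = i
          · subst h
            rw [inc_self]
            by_cases hz : res.d j (Pi.single k 1) l = 0
            · rw [hz]; simp
            obtain ⟨r, h0, h1, h2⟩ := res_deg res j k l hz
            rw [constantCoeff_eq]
            exact h2.coeff_eq_zero (by simpa using h0.symm)
          · rw [inc_ne _ _ _ _ _ h]; simp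

theorem betti_eq {c : ℕ → ℕ → ℕ} (hJ : HasRes J c) (hcc : ∀ q ∈ J, constantCoeff q = 0) (i j : ℕ) :
    res.toMinFreeResData.betti i j = c (i + 1) j := by
  classical
  obtain ⟨F, hF, hc⟩ := hJ
  let G := toGRes res hcc F.hI
  let eqv : {k : Fin (res.N i) // res.g i k = j} ≃ {k : G.ι // G.a k = i + 1 ∧ G.g k = j} :=
    Equiv.ofBijective (fun k => ⟨some ⟨i, k.1⟩, rfl, k.2⟩) (by
      constructor
      · rintro ⟨k, hk⟩ ⟨k', hk'⟩ h
        have h' := Option.some.inj (congrArg Subtype.val h)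
        exact Subtype.ext (eq_of_heq (Sigma.mk.inj h').2)
      · rintro ⟨_ | ⟨i', k⟩, h1, h2⟩
        · exact absurd h1 (by change ¬ (0 = i + 1); omega)
        · have : i' = i := by
            have h1 : i' + 1 = i + 1 := h1
            omega
          subst this
          exact ⟨⟨k, h2⟩, rfl⟩)
  have : Fintype {k : G.ι // G.a k = i + 1 ∧ G.g k = j} := Fintype.ofEquiv _ eqv
  have e1 : res.toMinFreeResData.betti i j = Fintype.card {k : G.ι // G.a k = i + 1 ∧ G.g k = j} := by
    rw [← Fintype.card_congr eqv, Fintype.card_subtype]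
    rfl
  rw [e1, ← hc, ← Fintype.card_subtype]
  exact le_antisymm (count_le G F _ _) (count_le F G _ _)

end conv

section loops

variable {h ℓ E : ℕ} {y1 y2 : ℕ → (σ →₀ ℕ)} {u : σ →₀ ℕ}

/-- first family -/
def S1 (y1 y2 : ℕ → (σ →₀ ℕ)) (n k : ℕ) : Set (σ →₀ ℕ) :=
  {m | ∃ i j, 1 ≤ i ∧ i < j ∧ (j ≤ n ∨ (j = n + 1 ∧ i ≤ k)) ∧ m = y1 j + y2 i}

/-- all generators -/
def S2 (h : ℕ) (y1 y2 : ℕ → (σ →₀ ℕ)) (u : σ →₀ ℕ) (c k : ℕ) : Set (σ →₀ ℕ) :=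
  S1 y1 y2 h 0 ∪ {m | ∃ a b, 1 ≤ a ∧ a ≤ b ∧ b ≤ h ∧ (h < b + c ∨ (b + c = h ∧ a ≤ k)) ∧
    m = y1 a + y1 b + u}

/-- standing assumptions -/
structure Good (h ℓ E : ℕ) (y1 y2 : ℕ → (σ →₀ ℕ)) (u : σ →₀ ℕ) : Prop where
  hℓ : 1 ≤ ℓ
  d1 : ∀ i, 1 ≤ i → i ≤ h → (y1 i).degree = ℓ
  d2 : ∀ i, 1 ≤ i → i ≤ h → (y2 i).degree = ℓ
  du : u.degree = E
  h11 : ∀ i j, 1 ≤ i → i ≤ h → 1 ≤ j → j ≤ h → i ≠ j → ∀ x, y1 i x ≠ 0 → y1 j x = 0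
  h22 : ∀ i j, 1 ≤ i → i ≤ h → 1 ≤ j → j ≤ h → i ≠ j → ∀ x, y2 i x ≠ 0 → y2 j x = 0
  h12 : ∀ i j, 1 ≤ i → i ≤ h → 1 ≤ j → j ≤ h → ∀ x, y1 i x ≠ 0 → y2 j x = 0
  h21 : ∀ i j, 1 ≤ i → i ≤ h → 1 ≤ j → j ≤ h → ∀ x, y2 i x ≠ 0 → y1 j x = 0
  h1u : ∀ i, 1 ≤ i → i ≤ h → ∀ x, y1 i x ≠ 0 → u x = 0
  h2u : ∀ i, 1 ≤ i → i ≤ h → ∀ x, y2 i x ≠ 0 → u x = 0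

theorem Good.deg (H : Good h ℓ E y1 y2 u) (X Z : Finset ℕ) (hX : ∀ i ∈ X, 1 ≤ i ∧ i ≤ h)
    (hZ : ∀ i ∈ Z, 1 ≤ i ∧ i ≤ h) : ∀ v ∈ X.disjSum Z, (Sum.elim y1 y2 v).degree = ℓ := by
  rintro (v | v) hv
  · have := hX v (by simpa using hv)
    exact H.d1 v this.1 this.2
  · have := hZ v (by simpa using hv)
    exact H.d2 v this.1 this.2

theorem Good.dis (H : Good h ℓ E y1 y2 u) (X Z : Finset ℕ) (hX : ∀ i ∈ X, 1 ≤ i ∧ i ≤ h)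
    (hZ : ∀ i ∈ Z, 1 ≤ i ∧ i ≤ h) : ∀ v ∈ X.disjSum Z, ∀ w ∈ X.disjSum Z, v ≠ w →
      ∀ x, Sum.elim y1 y2 v x ≠ 0 → Sum.elim y1 y2 w x = 0 := by
  rintro (v | v) hv (w | w) hw hne
  · have h1 := hX v (by simpa using hv)
    have h2 := hX w (by simpa using hw)
    exact H.h11 v w h1.1 h1.2 h2.1 h2.2 (by simpa using hne)
  · have h1 := hX v (by simpa using hv)
    have h2 := hZ w (by simpa using hw)
    exact H.h12 v w h1.1 h1.2 h2.1 h2.2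
  · have h1 := hZ v (by simpa using hv)
    have h2 := hX w (by simpa using hw)
    exact H.h21 v w h1.1 h1.2 h2.1 h2.2
  · have h1 := hZ v (by simpa using hv)
    have h2 := hZ w (by simpa using hw)
    exact H.h22 v w h1.1 h1.2 h2.1 h2.2 (by simpa using hne)

theorem loop1_inner (H : Good h ℓ E y1 y2 u) (n : ℕ) (hn : n + 1 ≤ h) (A : ℕ → ℕ)
    (h0 : HasRes (MI K (S1 y1 y2 n 0)) (cnt ℓ E A 0)) (k : ℕ) (hk : k ≤ n) :
    HasRes (MI K (S1 y1 y2 n k)) (cnt ℓ E (fun i => A i + k * (n - 1).choose i) 0) := by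
  induction k with
  | zero => simpa using h0
  | succ k ih =>
    have ih := ih (by omega)
    have hX : ∀ i ∈ Finset.Ioo (k + 1) (n + 1), 1 ≤ i ∧ i ≤ h := by
      intro i hi; rw [Finset.mem_Ioo] at hi; omega
    have hZ : ∀ i ∈ Finset.Ico 1 (k + 1), 1 ≤ i ∧ i ≤ h := by
      intro i hi; rw [Finset.mem_Ico] at hi; omega
    have hm : (y1 (n + 1) + y2 (k + 1)).degree = 2 * ℓ := by
      rw [map_add, H.d1 _ (by omega) (by omega), H.d2 _ (by omega) (by omega)]; ring
    have := step1 (Sum.elim y1 y2) ℓ E H.hℓ ((Finset.Ioo (k + 1) (n + 1)).disjSum (Finset.Ico 1 (k + 1)))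
      (H.deg _ _ hX hZ) (H.dis _ _ hX hZ) ih (y1 (n + 1) + y2 (k + 1)) hm (by
        rintro (v | v) hv
        · simp only [Finset.inl_mem_disjSum, Finset.mem_Ioo] at hv
          refine ⟨y1 v + y2 (k + 1), ⟨k + 1, v, by omega, by omega, by omega, rfl⟩, ?_⟩
          intro x; simp
        · simp only [Finset.inr_mem_disjSum, Finset.mem_Ico] at hv
          refine ⟨y1 (n + 1) + y2 v, ⟨v, n + 1, by omega, by omega, by omega, rfl⟩, ?_⟩
          intro x; simp; omega) (by
        rintro s ⟨i, j, hi, hij, hj, rfl⟩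
        by_cases hik : i < k + 1
        · refine ⟨Sum.inr i, by simp; omega, le_tsub_of_disj (by intro x; simp) ?_⟩
          intro x hx
          simp only [Sum.elim_inr] at hx
          simp [H.h21 i (n + 1) (by omega) (by omega) (by omega) (by omega) x hx,
            H.h22 i (k + 1) (by omega) (by omega) (by omega) (by omega) (by omega) x hx]
        · refine ⟨Sum.inl j, by simp; omega, le_tsub_of_disj (by intro x; simp) ?_⟩
          intro x hx
          simp only [Sum.elim_inl] at hx
          simp [H.h11 j (n + 1) (by omega) (by omega) (by omega) (by omega) (by omega) x hx,
            H.h12 j (k + 1) (by omega) (by omega) (by omega) (by omega) x hx])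
    refine this.congr ?_ ?_
    · congr 1
      ext m
      simp only [S1, Set.mem_insert_iff, Set.mem_setOf_eq]
      constructor
      · rintro (rfl | ⟨i, j, hi, hij, hj, rfl⟩)
        · exact ⟨k + 1, n + 1, by omega, by omega, by omega, rfl⟩
        · exact ⟨i, j, hi, hij, by omega, rfl⟩
      · rintro ⟨i, j, hi, hij, hj, rfl⟩
        by_cases hc : j = n + 1 ∧ i = k + 1
        · left; rw [hc.1, hc.2]
        · right; exact ⟨i, j, hi, hij, by omega, rfl⟩
    · intro i j
      rw [Finset.card_disjSum, Nat.card_Ioo, Nat.card_Ico, show n + 1 - (k + 1) - 1 + (k + 1 - 1) = n - 1 by omega]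
      congr 1
      ext i; ring

theorem loop1 (H : Good h ℓ E y1 y2 u) (n : ℕ) (hn : n ≤ h) :
    HasRes (MI K (S1 y1 y2 n 0)) (cnt ℓ E (fun i => (i + 1) * n.choose (i + 2)) 0) := by
  induction n with
  | zero =>
    refine hasRes_bot.congr ?_ ?_
    · have : S1 y1 y2 0 0 = ∅ := by
        ext m
        simp only [S1, Set.mem_setOf_eq, Set.mem_empty_iff_false, iff_false]
        rintro ⟨i, j, hi, hij, hj, rfl⟩
        omega
      rw [this]; simp [MI]
    · intro i j
      rcases i with _ | i <;> simp [cnt]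
  | succ n ih =>
    refine (loop1_inner H n hn _ (ih (by omega)) n le_rfl).congr ?_ ?_
    · congr 1
      ext m
      simp only [S1, Set.mem_setOf_eq]
      constructor
      · rintro ⟨i, j, hi, hij, hj, rfl⟩
        exact ⟨i, j, hi, hij, by omega, rfl⟩
      · rintro ⟨i, j, hi, hij, hj, rfl⟩
        exact ⟨i, j, hi, hij, by omega, rfl⟩
    · intro i j
      congr 1
      ext i
      exact final_count1 n i

theorem loop2_inner (H : Good h ℓ E y1 y2 u) (c : ℕ) (hc : c < h) (A B : ℕ → ℕ)
    (h0 : HasRes (MI K (S2 h y1 y2 u c 0)) (cnt ℓ E A B)) (k : ℕ) (hk : k ≤ h - c) :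
    HasRes (MI K (S2 h y1 y2 u c k)) (cnt ℓ E A (fun i => B i + ∑ a ∈ Finset.range k, (h - 1 + a).choose i)) := by
  induction k with
  | zero => simpa using h0
  | succ k ih =>
    have ih := ih (by omega)
    obtain ⟨b, hb⟩ : ∃ b, b + c = h := ⟨h - c, by omega⟩
    have hdisj : Disjoint (Finset.Ico 1 (k + 1)) (Finset.Ioc b h) := by
      rw [Finset.disjoint_left]
      intro i hi hi'
      rw [Finset.mem_Ico] at hi; rw [Finset.mem_Ioc] at hi'; omega
    have hX : ∀ i ∈ (Finset.Ico 1 (k + 1)).disjUnion (Finset.Ioc b h) hdisj, 1 ≤ i ∧ i ≤ h := by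
      intro i hi; rw [Finset.mem_disjUnion, Finset.mem_Ico, Finset.mem_Ioc] at hi; omega
    have hZ : ∀ i ∈ Finset.Ico 1 b, 1 ≤ i ∧ i ≤ h := by
      intro i hi; rw [Finset.mem_Ico] at hi; omega
    have hm : (y1 (k + 1) + y1 b + u).degree = 2 * ℓ + E := by
      rw [map_add, map_add, H.d1 _ (by omega) (by omega), H.d1 _ (by omega) (by omega), H.du]; ring
    have c1 : ∀ j, j ≠ k + 1 → j ≠ b → 1 ≤ j → j ≤ h → ∀ x, y1 j x ≠ 0 → (y1 (k + 1) + y1 b + u) x = 0 := by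
      intro j h1 h2 h3 h4 x hx
      simp [H.h11 j (k + 1) (by omega) (by omega) (by omega) (by omega) (by omega) x hx,
        H.h11 j b (by omega) (by omega) (by omega) (by omega) (by omega) x hx,
        H.h1u j (by omega) (by omega) x hx]
    have c2 : ∀ j, 1 ≤ j → j ≤ h → ∀ x, y2 j x ≠ 0 → (y1 (k + 1) + y1 b + u) x = 0 := by
      intro j h3 h4 x hx
      simp [H.h21 j (k + 1) (by omega) (by omega) (by omega) (by omega) x hx,
        H.h21 j b (by omega) (by omega) (by omega) (by omega) x hx,
        H.h2u j (by omega) (by omega) x hx]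
    have := step2 (Sum.elim y1 y2) ℓ E H.hℓ
      (((Finset.Ico 1 (k + 1)).disjUnion (Finset.Ioc b h) hdisj).disjSum (Finset.Ico 1 b))
      (H.deg _ _ hX hZ) (H.dis _ _ hX hZ) ih (y1 (k + 1) + y1 b + u) hm (by
        rintro (v | v) hv
        · simp only [Finset.inl_mem_disjSum, Finset.mem_disjUnion, Finset.mem_Ico, Finset.mem_Ioc] at hv
          rcases hv with hv | hv
          · refine ⟨y1 v + y1 b + u, Or.inr ⟨v, b, by omega, by omega, by omega, by omega, rfl⟩, ?_⟩
            intro x; simp; omega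
          · refine ⟨y1 (k + 1) + y1 v + u, Or.inr ⟨k + 1, v, by omega, by omega, by omega, by omega, rfl⟩, ?_⟩
            intro x; simp; omega
        · simp only [Finset.inr_mem_disjSum, Finset.mem_Ico] at hv
          refine ⟨y1 b + y2 v, Or.inl ⟨v, b, by omega, by omega, by omega, rfl⟩, ?_⟩
          intro x; simp; omega) (by
        rintro s (⟨i, j, hi, hij, hj, rfl⟩ | ⟨a', b', ha, hab, hbh, hcase, rfl⟩)
        · by_cases hik : i < b
          · exact ⟨Sum.inr i, by simp; omega, le_tsub_of_disj (by intro x; simp)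
              (c2 i (by omega) (by omega))⟩
          · exact ⟨Sum.inl j, by simp; omega, le_tsub_of_disj (by intro x; simp)
              (c1 j (by omega) (by omega) (by omega) (by omega))⟩
        · by_cases hb' : b' = b
          · exact ⟨Sum.inl a', by simp; omega, le_tsub_of_disj (by intro x; simp; omega)
              (c1 a' (by omega) (by omega) (by omega) (by omega))⟩
          · exact ⟨Sum.inl b', by simp; omega, le_tsub_of_disj (by intro x; simp; omega)
              (c1 b' (by omega) (by omega) (by omega) (by omega))⟩)
    refine this.congr ?_ ?_
    · congr 1
      ext m
      simp only [S2, Set.mem_insert_iff, Set.mem_union, Set.mem_setOf_eq]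
      constructor
      · rintro (rfl | h1 | ⟨a', b', ha, hab, hbh, hcase, rfl⟩)
        · exact Or.inr ⟨k + 1, b, by omega, by omega, by omega, by omega, rfl⟩
        · exact Or.inl h1
        · exact Or.inr ⟨a', b', ha, hab, hbh, by omega, rfl⟩
      · rintro (h1 | ⟨a', b', ha, hab, hbh, hcase, rfl⟩)
        · exact Or.inr (Or.inl h1)
        · by_cases hc : a' = k + 1 ∧ b' = b
          · left; rw [hc.1, hc.2]
          · exact Or.inr (Or.inr ⟨a', b', ha, hab, hbh, by omega, rfl⟩)
    · intro i j
      rw [Finset.card_disjSum, Finset.card_disjUnion, Nat.card_Ioc, Nat.card_Ico, Nat.card_Ico,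
        show k + 1 - 1 + (h - b) + (b - 1) = h - 1 + k by omega]
      congr 1
      ext i
      rw [Finset.sum_range_succ]; ring

theorem loop2 (H : Good h ℓ E y1 y2 u) (c : ℕ) (hc : c ≤ h) :
    HasRes (MI K (S2 h y1 y2 u c 0)) (cnt ℓ E (fun i => (i + 1) * h.choose (i + 2))
      (fun i => ∑ c' ∈ Finset.range c, ∑ a ∈ Finset.range (h - c'), (h - 1 + a).choose i)) := by
  induction c with
  | zero =>
    refine (loop1 H h le_rfl).congr ?_ ?_
    · congr 1
      ext m
      simp only [S2, Set.mem_union, Set.mem_setOf_eq]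
      constructor
      · exact Or.inl
      · rintro (h1 | ⟨a', b', ha, hab, hbh, hcase, rfl⟩)
        · exact h1
        · omega
    · intro i j
      congr 1
  | succ c ih =>
    refine (loop2_inner H c hc _ _ (ih (by omega)) (h - c) le_rfl).congr ?_ ?_
    · congr 1
      ext m
      simp only [S2, Set.mem_union, Set.mem_setOf_eq]
      constructor
      · rintro (h1 | ⟨a', b', ha, hab, hbh, hcase, rfl⟩)
        · exact Or.inl h1
        · exact Or.inr ⟨a', b', ha, hab, hbh, by omega, rfl⟩
      · rintro (h1 | ⟨a', b', ha, hab, hbh, hcase, rfl⟩)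
        · exact Or.inl h1
        · exact Or.inr ⟨a', b', ha, hab, hbh, by omega, rfl⟩
    · intro i j
      congr 1
      ext i
      rw [Finset.sum_range_succ]

end loops

theorem disj_apply {p q : σ →₀ ℕ} (h : Disjoint p.support q.support) : ∀ x, p x ≠ 0 → q x = 0 := by
  intro x hx
  by_contra h'
  exact Finset.disjoint_left.1 h (Finsupp.mem_support_iff.2 hx) (Finsupp.mem_support_iff.2 h')

theorem deg_of_total {p : σ →₀ ℕ} {n : ℕ} (h : (monomial p (1 : K)).totalDegree = n) : p.degree = n := by
  rw [totalDegree_monomial _ one_ne_zero] at h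
  exact h

end Aux

/-- Betti numbers of the initial ideal `J` of `I_{B_{ℓ,h}^{s,t}}`: for pairwise
support-disjoint monomials `Y_{1,i}, Y_{2,i}` (of degree `ℓ`) and `U` (of degree `s+t+1`),
the ideal generated by `{Y_{1,j}Y_{2,i} : i<j} ∪ {Y_{1,i}Y_{1,j}U : i<j} ∪ {Y_{1,i}²U}`
has `β_{i,j}(J) = (i+1)·C(h,i+2)` if `j = ℓ(i+2)`,
`β_{i,j}(J) = C(2h,i+2) − (i+3)·C(h,i+2)` if `j = ℓ(i+2)+s+t+1`, and `0` otherwise. -/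
theorem stmt_19 {K : Type} [Field K] {σ : Type} (h ℓ s t : ℕ)
    (hh : 2 ≤ h) (hℓ : 1 ≤ ℓ) (hs : 1 ≤ s) (ht : 1 ≤ t)
    (y1 y2 : ℕ → (σ →₀ ℕ)) (u : σ →₀ ℕ)
    (hdeg1 : ∀ i, 1 ≤ i → i ≤ h → (monomial (y1 i) (1 : K)).totalDegree = ℓ)
    (hdeg2 : ∀ i, 1 ≤ i → i ≤ h → (monomial (y2 i) (1 : K)).totalDegree = ℓ)
    (hdegu : (monomial u (1 : K)).totalDegree = s + t + 1)
    (hdisj11 : ∀ i j, 1 ≤ i → i ≤ h → 1 ≤ j → j ≤ h → i ≠ j →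
      Disjoint (y1 i).support (y1 j).support)
    (hdisj22 : ∀ i j, 1 ≤ i → i ≤ h → 1 ≤ j → j ≤ h → i ≠ j →
      Disjoint (y2 i).support (y2 j).support)
    (hdisj12 : ∀ i j, 1 ≤ i → i ≤ h → 1 ≤ j → j ≤ h →
      Disjoint (y1 i).support (y2 j).support)
    (hdisj1u : ∀ i, 1 ≤ i → i ≤ h → Disjoint (y1 i).support u.support)
    (hdisj2u : ∀ i, 1 ≤ i → i ≤ h → Disjoint (y2 i).support u.support)
    (Y1 Y2 : ℕ → MvPolynomial σ K) (U : MvPolynomial σ K)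
    (hY1 : ∀ i, Y1 i = monomial (y1 i) 1) (hY2 : ∀ i, Y2 i = monomial (y2 i) 1)
    (hU : U = monomial u 1)
    (J : Ideal (MvPolynomial σ K))
    (hJ : J = Ideal.span
      ({x | ∃ i j, 1 ≤ i ∧ i < j ∧ j ≤ h ∧ x = Y1 j * Y2 i} ∪
       {x | ∃ i j, 1 ≤ i ∧ i < j ∧ j ≤ h ∧ x = Y1 i * Y1 j * U} ∪
       {x | ∃ i, 1 ≤ i ∧ i ≤ h ∧ x = Y1 i * Y1 i * U}))
    (res : MinFreeResOfIdeal J) (i j : ℕ) :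
    res.toMinFreeResData.betti i j =
      if j = ℓ * (i + 2) then (i + 1) * Nat.choose h (i + 2)
      else if j = ℓ * (i + 2) + s + t + 1 then
        Nat.choose (2 * h) (i + 2) - (i + 3) * Nat.choose h (i + 2)
      else 0 := by
  have H : Good h ℓ (s + t + 1) y1 y2 u :=
    { hℓ := hℓ
      d1 := fun i h1 h2 => deg_of_total (hdeg1 i h1 h2)
      d2 := fun i h1 h2 => deg_of_total (hdeg2 i h1 h2)
      du := deg_of_total hdegu
      h11 := fun i j a b c d e => disj_apply (hdisj11 i j a b c d e)
      h22 := fun i j a b c d e => disj_apply (hdisj22 i j a b c d e)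
      h12 := fun i j a b c d => disj_apply (hdisj12 i j a b c d)
      h21 := fun i j a b c d => disj_apply (hdisj12 j i c d a b).symm
      h1u := fun i a b => disj_apply (hdisj1u i a b)
      h2u := fun i a b => disj_apply (hdisj2u i a b) }
  have hJ' : J = MI K (S2 h y1 y2 u h 0) := by
    rw [hJ, MI]
    congr 1
    ext x
    simp only [Set.mem_union, Set.mem_setOf_eq, S2, S1, Set.mem_image, hY1, hY2, hU, monomial_mul, mul_one]
    constructor
    · rintro ((⟨i, j, h1, h2, h3, rfl⟩ | ⟨i, j, h1, h2, h3, rfl⟩) | ⟨i, h1, h2, rfl⟩)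
      · exact ⟨_, Or.inl ⟨i, j, h1, h2, by omega, rfl⟩, rfl⟩
      · exact ⟨_, Or.inr ⟨i, j, h1, by omega, h3, by omega, rfl⟩, rfl⟩
      · exact ⟨_, Or.inr ⟨i, i, h1, by omega, h2, by omega, rfl⟩, rfl⟩
    · rintro ⟨m, (⟨i, j, h1, h2, h3, rfl⟩ | ⟨a, b, h1, h2, h3, h4, rfl⟩), rfl⟩
      · exact Or.inl (Or.inl ⟨i, j, h1, h2, by omega, rfl⟩)
      · rcases h2.eq_or_lt with rfl | h2
        · exact Or.inr ⟨a, h1, h3, rfl⟩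
        · exact Or.inl (Or.inr ⟨a, b, h1, h2, h3, rfl⟩)
  have hres := loop2 (K := K) H h le_rfl
  rw [← hJ'] at hres
  have hcc : ∀ q ∈ J, constantCoeff q = 0 := by
    have : J ≤ RingHom.ker (constantCoeff (R := K) (σ := σ)) := by
      rw [hJ', MI, Ideal.span_le]
      rintro _ ⟨m, hm, rfl⟩
      rw [SetLike.mem_coe, RingHom.mem_ker, constantCoeff_eq]
      have hm0 : m.degree ≠ 0 := by
        rcases hm with ⟨i, j, h1, h2, h3, rfl⟩ | ⟨a, b, h1, h2, h3, h4, rfl⟩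
        · rw [map_add, H.d1 j (by omega) (by omega)]; omega
        · rw [map_add, map_add, H.d1 a (by omega) (by omega)]; omega
      refine (isHomogeneous_monomial (1 : K) (rfl : m.degree = m.degree)).coeff_eq_zero ?_
      simpa using hm0.symm
    exact fun q hq => this hq
  rw [betti_eq res hres hcc i j]
  simp only [cnt]
  rw [final_count h i (by omega)]
  by_cases h1 : j = ℓ * (i + 2)
  · rw [if_pos h1, if_pos h1, if_neg (by omega), add_zero]
  · rw [if_neg h1, if_neg h1, zero_add, ← add_assoc, ← add_assoc]
end
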